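/- arXiv:2603.20761 — 3 statements merged into one kernel-verified Lean document; each statement's English description precedes it below -/
import Mathlib

section
/- Let V₁ and V₂ be isometries defining irreducible quantum Markov chains with the same environment dimension k and system dimensions d₁ and d₂, with stationary states ρ₁ˢˢ, ρ₂ˢˢ and Kraus operators K_{1,j}, K_{2,j} (j = 0,…,k−1). Then the following are equivalent: (i) the chains are output equivalent, i.e. for every n ≥ 1 and all words i, j ∈ {0,…,k−1}ⁿ one has tr(K_{1,i} ρ₁ˢˢ K_{1,j}ᴴ) = tr(K_{2,i} ρ₂ˢˢ K_{2,j}ᴴ); (ii) d₁ = d₂ and there exist a unitary d₁×d₂ complex matrix W and ω ∈ ℝ such that K_{2,j} = e^{iω} Wᴴ K_{1,j} W for all j and ρ₂ˢˢ = Wᴴ ρ₁ˢˢ W; (iii) d₁ = d₂ and there exist a unitary d₁×d₂ complex matrix W and ω ∈ ℝ such that (W ⊗ 1_k) V₂ = e^{iω} V₁ W. -/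
open Matrix Filter
open scoped Kronecker ComplexConjugate ComplexOrder

noncomputable section

namespace QMCPaper

/-- The `j`-th block (Kraus operator style) of a `(d₁·k)×d₂` matrix. -/
def blk {d₁ d₂ k : ℕ} (V : Matrix (Fin d₁ × Fin k) (Fin d₂) ℂ) (j : Fin k) :
    Matrix (Fin d₁) (Fin d₂) ℂ :=
  fun a b => V (a, j) b

/-- The Kraus operators of a QMC isometry. -/
def kraus {d k : ℕ} (V : Matrix (Fin d × Fin k) (Fin d) ℂ) (j : Fin k) :
    Matrix (Fin d) (Fin d) ℂ :=
  blk V j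

/-- The transition channel `T_V(X) = Vᴴ (X ⊗ 1_k) V = Σ_j K_jᴴ X K_j`. -/
def chan {d k : ℕ} (V : Matrix (Fin d × Fin k) (Fin d) ℂ)
    (X : Matrix (Fin d) (Fin d) ℂ) : Matrix (Fin d) (Fin d) ℂ :=
  ∑ j : Fin k, (kraus V j)ᴴ * X * kraus V j

/-- The predual channel `T_{V*}(ρ) = Σ_j K_j ρ K_jᴴ`. -/
def predual {d k : ℕ} (V : Matrix (Fin d × Fin k) (Fin d) ℂ)
    (ρ : Matrix (Fin d) (Fin d) ℂ) : Matrix (Fin d) (Fin d) ℂ :=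
  ∑ j : Fin k, kraus V j * ρ * (kraus V j)ᴴ

/-- A state: positive semidefinite matrix of trace one. -/
def IsState {d : ℕ} (ρ : Matrix (Fin d) (Fin d) ℂ) : Prop :=
  ρ.PosSemidef ∧ ρ.trace = 1

/-- `V` is an isometry defining an irreducible QMC with (unique, faithful) stationary
state `ρss`. -/
def IsIrreducible {d k : ℕ} (V : Matrix (Fin d × Fin k) (Fin d) ℂ)
    (ρss : Matrix (Fin d) (Fin d) ℂ) : Prop :=
  Vᴴ * V = 1 ∧ IsState ρss ∧ predual V ρss = ρss ∧ ρss.PosDef ∧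
    ∀ ρ, IsState ρ → predual V ρ = ρ → ρ = ρss

/-- For a word `i = (i_0, …, i_{n-1})`, the operator `K_i = K_{i_{n-1}} ⋯ K_{i_0}`. -/
def krausWord {d k : ℕ} (V : Matrix (Fin d × Fin k) (Fin d) ℂ) {n : ℕ}
    (i : Fin n → Fin k) : Matrix (Fin d) (Fin d) ℂ :=
  ((List.ofFn i).reverse.map (kraus V)).prod

/-- The output state at time `n` with initial system state `ρ`:
its `(i,j)` entry is `tr(K_i ρ K_jᴴ)`. -/
def outState {d k : ℕ} (V : Matrix (Fin d × Fin k) (Fin d) ℂ)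
    (ρ : Matrix (Fin d) (Fin d) ℂ) (n : ℕ) :
    Matrix (Fin n → Fin k) (Fin n → Fin k) ℂ :=
  fun i j => (krausWord V i * ρ * (krausWord V j)ᴴ).trace

/-- Output equivalence (with given initial states): equality of all output states. -/
def OutputEquiv {d₁ d₂ k : ℕ}
    (V₁ : Matrix (Fin d₁ × Fin k) (Fin d₁) ℂ) (ρ₁ : Matrix (Fin d₁) (Fin d₁) ℂ)
    (V₂ : Matrix (Fin d₂ × Fin k) (Fin d₂) ℂ) (ρ₂ : Matrix (Fin d₂) (Fin d₂) ℂ) : Prop :=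
  ∀ n : ℕ, 1 ≤ n → ∀ i j : Fin n → Fin k,
    (krausWord V₁ i * ρ₁ * (krausWord V₁ j)ᴴ).trace =
      (krausWord V₂ i * ρ₂ * (krausWord V₂ j)ᴴ).trace

/-- A (possibly rectangular) unitary matrix. -/
def IsUnitaryMat {d₁ d₂ : ℕ} (W : Matrix (Fin d₁) (Fin d₂) ℂ) : Prop :=
  Wᴴ * W = 1 ∧ W * Wᴴ = 1

end QMCPaper

namespace QMCPaper

open scoped Topology

theorem pow_tendsto_zero {E : Type*} [NormedAddCommGroup E] [NormedSpace ℂ E]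
    [FiniteDimensional ℂ E] (f : Module.End ℂ E)
    (hf : ∀ μ : ℂ, f.HasEigenvalue μ → ‖μ‖ < 1) (x : E) :
    Tendsto (fun n : ℕ => (f ^ n) x) atTop (𝓝 0) := by
  rcases subsingleton_or_nontrivial E with hE | hE
  · have : (fun n : ℕ => (f ^ n) x) = fun _ => 0 := funext fun n => Subsingleton.elim _ _
    rw [this]; exact tendsto_const_nhds
  have : CompleteSpace E := FiniteDimensional.complete ℂ E
  set a : E →L[ℂ] E := Module.End.toContinuousLinearMap E f with ha
  have hspec : spectrum ℂ a = spectrum ℂ f :=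
    AlgEquiv.spectrum_eq (Module.End.toContinuousLinearMap (𝕜 := ℂ) E) f
  have hr : spectralRadius ℂ a < ((1 : NNReal) : ENNReal) := by
    apply spectrum.spectralRadius_lt_of_forall_lt
    intro z hz
    rw [hspec, ← Module.End.hasEigenvalue_iff_mem_spectrum] at hz
    have := hf z hz
    exact_mod_cast this
  obtain ⟨s, hs1, hs2⟩ := ENNReal.lt_iff_exists_nnreal_btwn.1 hr
  have hs2' : s < 1 := by exact_mod_cast hs2
  have hT := spectrum.pow_nnnorm_pow_one_div_tendsto_nhds_spectralRadius a
  have hev : ∀ᶠ n : ℕ in atTop, ‖a ^ n‖ ≤ (s : ℝ) ^ n := by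
    filter_upwards [hT.eventually_lt_const hs1, eventually_gt_atTop 0] with n hn hn0
    have h1 : (‖a ^ n‖₊ : ENNReal) ≤ (s : ENNReal) ^ (n : ℝ) := by
      have := ENNReal.rpow_le_rpow hn.le (z := (n : ℝ)) (by positivity)
      rwa [← ENNReal.rpow_mul, one_div, inv_mul_cancel₀ (by positivity), ENNReal.rpow_one] at this
    rw [ENNReal.rpow_natCast] at h1
    have h2 : ‖a ^ n‖₊ ≤ s ^ n := by exact_mod_cast h1
    exact_mod_cast h2
  have hpow : Tendsto (fun n : ℕ => (s : ℝ) ^ n * ‖x‖) atTop (𝓝 0) := by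
    simpa using (tendsto_pow_atTop_nhds_zero_of_lt_one s.2 (by exact_mod_cast hs2')).mul_const ‖x‖
  refine squeeze_zero_norm' ?_ hpow
  filter_upwards [hev] with n hn
  have h3 : (f ^ n) x = (a ^ n) x := by
    rw [ha, ← map_pow]; rfl
  rw [h3]
  exact ((a ^ n).le_opNorm x).trans (by gcongr)

/-- mixed transfer operator -/
def mixF {d₁ d₂ k : ℕ} (V₁ : Matrix (Fin d₁ × Fin k) (Fin d₁) ℂ)
    (V₂ : Matrix (Fin d₂ × Fin k) (Fin d₂) ℂ) : Module.End ℂ (Matrix (Fin d₁) (Fin d₂) ℂ) where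
  toFun Y := ∑ j : Fin k, (kraus V₁ j)ᴴ * Y * kraus V₂ j
  map_add' X Y := by simp [Matrix.mul_add, Matrix.add_mul, Finset.sum_add_distrib]
  map_smul' c Y := by simp [Finset.smul_sum]

theorem mixF_apply {d₁ d₂ k : ℕ} (V₁ : Matrix (Fin d₁ × Fin k) (Fin d₁) ℂ)
    (V₂ : Matrix (Fin d₂ × Fin k) (Fin d₂) ℂ) (Y : Matrix (Fin d₁) (Fin d₂) ℂ) :
    mixF V₁ V₂ Y = ∑ j : Fin k, (kraus V₁ j)ᴴ * Y * kraus V₂ j := rfl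

theorem mixF_tendsto {d₁ d₂ k : ℕ} (V₁ : Matrix (Fin d₁ × Fin k) (Fin d₁) ℂ)
    (V₂ : Matrix (Fin d₂ × Fin k) (Fin d₂) ℂ)
    (hf : ∀ μ : ℂ, (mixF V₁ V₂).HasEigenvalue μ → ‖μ‖ < 1) (Y : Matrix (Fin d₁) (Fin d₂) ℂ) :
    Tendsto (fun n : ℕ => (mixF V₁ V₂ ^ n) Y) atTop (𝓝 0) := by
  let : NormedAddCommGroup (Matrix (Fin d₁) (Fin d₂) ℂ) := Matrix.normedAddCommGroup
  let : NormedSpace ℂ (Matrix (Fin d₁) (Fin d₂) ℂ) := Matrix.normedSpace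
  exact pow_tendsto_zero (mixF V₁ V₂) hf Y

theorem krausWord_cons {d k n : ℕ} (V : Matrix (Fin d × Fin k) (Fin d) ℂ) (x : Fin k)
    (i : Fin n → Fin k) :
    krausWord V (Fin.cons x i : Fin (n + 1) → Fin k) = krausWord V i * kraus V x := by
  simp [krausWord, List.ofFn_succ]

theorem mixF_pow {d₁ d₂ k : ℕ} (V₁ : Matrix (Fin d₁ × Fin k) (Fin d₁) ℂ)
    (V₂ : Matrix (Fin d₂ × Fin k) (Fin d₂) ℂ) (n : ℕ) (Y : Matrix (Fin d₁) (Fin d₂) ℂ) :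
    (mixF V₁ V₂ ^ n) Y = ∑ i : Fin n → Fin k, (krausWord V₁ i)ᴴ * Y * krausWord V₂ i := by
  induction n with
  | zero => simp [krausWord]
  | succ n ih =>
    rw [pow_succ', Module.End.mul_apply, ih, mixF_apply,
      ← (Fin.consEquiv (fun _ => Fin k)).sum_comp, Fintype.sum_prod_type]
    refine Finset.sum_congr rfl fun x _ => ?_
    rw [Matrix.mul_sum, Matrix.sum_mul]
    refine Finset.sum_congr rfl fun i _ => ?_
    have := krausWord_cons V₁ x i
    have h2 := krausWord_cons V₂ x i
    simp only [Fin.consEquiv, Equiv.coe_fn_mk, this, h2, conjTranspose_mul, Matrix.mul_assoc]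

theorem sum_kraus {d k : ℕ} {V : Matrix (Fin d × Fin k) (Fin d) ℂ} (h : Vᴴ * V = 1) :
    ∑ j : Fin k, (kraus V j)ᴴ * kraus V j = 1 := by
  rw [← h]
  ext a b
  simp only [Matrix.sum_apply, Matrix.mul_apply, Fintype.sum_prod_type, conjTranspose_apply,
    kraus, blk]
  exact Finset.sum_comm

theorem exists_factor {d : ℕ} {ρ : Matrix (Fin d) (Fin d) ℂ} (h : ρ.PosSemidef) :
    ∃ B : Matrix (Fin d) (Fin d) ℂ, ρ = B * Bᴴ := by
  open scoped MatrixOrder Matrix.Norms.L2Operator in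
  obtain ⟨B, rfl⟩ := CStarAlgebra.nonneg_iff_eq_star_mul_self.mp h.nonneg
  exact ⟨Bᴴ, by simp [star_eq_conjTranspose]⟩

theorem trace_sandwich_nonneg {m d : ℕ} {ρ : Matrix (Fin d) (Fin d) ℂ} (h : ρ.PosSemidef)
    (D : Matrix (Fin m) (Fin d) ℂ) : 0 ≤ (D * ρ * Dᴴ).trace :=
  (h.mul_mul_conjTranspose_same D).trace_nonneg

theorem sandwich_eq_zero {m d : ℕ} {ρ : Matrix (Fin d) (Fin d) ℂ} (h : ρ.PosDef)
    (D : Matrix (Fin m) (Fin d) ℂ) (h0 : (D * ρ * Dᴴ).trace = 0) : D = 0 := by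
  obtain ⟨B, hB⟩ := exists_factor h.posSemidef
  have h1 : ((D * B) * (D * B)ᴴ).trace = 0 := by
    rw [← h0, hB]; simp [Matrix.mul_assoc]
  rw [trace_mul_conjTranspose_self_eq_zero_iff] at h1
  have h2 : D * ρ = 0 := by rw [hB, ← Matrix.mul_assoc, h1, Matrix.zero_mul]
  have hu : IsUnit ρ.det := (Matrix.isUnit_iff_isUnit_det _).1 h.isUnit
  calc D = D * ρ * ρ⁻¹ := by rw [Matrix.mul_nonsing_inv_cancel_right _ _ hu]
    _ = 0 := by rw [h2, Matrix.zero_mul]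

theorem trace_self {α β : Type*} [Fintype α] [Fintype β] (X : Matrix α β ℂ) :
    (Xᴴ * X).trace = ((∑ b, ∑ a, ‖X a b‖ ^ 2 : ℝ) : ℂ) := by
  simp only [Matrix.trace, Matrix.diag, Matrix.mul_apply, conjTranspose_apply]
  push_cast
  refine Finset.sum_congr rfl fun b _ => Finset.sum_congr rfl fun a _ => ?_
  rw [Complex.star_def, Complex.conj_mul']

theorem purity {ι α β : Type*} [Fintype ι] [Fintype α] [Fintype β]
    (A₁ : Matrix ι α ℂ) (A₂ : Matrix ι β ℂ) (h : A₁ * A₁ᴴ = A₂ * A₂ᴴ) (a b : α) :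
    ‖(A₁ᴴ * A₁) a b‖ ^ 2 ≤ ∑ d, ∑ c, ‖(A₁ᴴ * A₂) c d‖ ^ 2 := by
  have key : ((A₁ᴴ * A₁)ᴴ * (A₁ᴴ * A₁)).trace = ((A₁ᴴ * A₂)ᴴ * (A₁ᴴ * A₂)).trace := by
    calc ((A₁ᴴ * A₁)ᴴ * (A₁ᴴ * A₁)).trace = ((A₁ * A₁ᴴ) * (A₁ * A₁ᴴ)).trace := by
          rw [conjTranspose_mul, conjTranspose_conjTranspose, Matrix.mul_assoc,
            Matrix.trace_mul_comm]
          simp only [Matrix.mul_assoc]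
      _ = ((A₁ * A₁ᴴ) * (A₂ * A₂ᴴ)).trace := by rw [← h]
      _ = _ := by
          rw [← Matrix.mul_assoc, Matrix.trace_mul_comm]
          simp only [conjTranspose_mul, conjTranspose_conjTranspose, Matrix.mul_assoc]
  rw [trace_self, trace_self] at key
  have key' := Complex.ofReal_injective key
  rw [← key']
  refine le_trans ?_ (Finset.single_le_sum (f := fun b => ∑ a, ‖(A₁ᴴ * A₁) a b‖ ^ 2)
    (fun _ _ => Finset.sum_nonneg fun _ _ => by positivity) (Finset.mem_univ b))
  exact Finset.single_le_sum (f := fun a => ‖(A₁ᴴ * A₁) a b‖ ^ 2)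
    (fun _ _ => by positivity) (Finset.mem_univ a)

/-- the vectors generating the output state -/
def amp {d k : ℕ} (V : Matrix (Fin d × Fin k) (Fin d) ℂ) (B : Matrix (Fin d) (Fin d) ℂ) (n : ℕ) :
    Matrix (Fin n → Fin k) (Fin d × Fin d) ℂ :=
  fun i p => (krausWord V i * B) p.1 p.2

theorem amp_out {d k : ℕ} (V : Matrix (Fin d × Fin k) (Fin d) ℂ) (B : Matrix (Fin d) (Fin d) ℂ)
    (n : ℕ) (i j : Fin n → Fin k) :
    (amp V B n * (amp V B n)ᴴ) i j = (krausWord V i * (B * Bᴴ) * (krausWord V j)ᴴ).trace := by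
  have : krausWord V i * (B * Bᴴ) * (krausWord V j)ᴴ
      = (krausWord V i * B) * (krausWord V j * B)ᴴ := by
    simp [Matrix.mul_assoc]
  rw [this]
  simp only [Matrix.trace, Matrix.diag, Matrix.mul_apply (M := amp V B n),
    Matrix.mul_apply (M := krausWord V i * B),
    conjTranspose_apply, Fintype.sum_prod_type, amp]

theorem amp_overlap {d₁ d₂ k : ℕ} (V₁ : Matrix (Fin d₁ × Fin k) (Fin d₁) ℂ)
    (V₂ : Matrix (Fin d₂ × Fin k) (Fin d₂) ℂ) (B₁ : Matrix (Fin d₁) (Fin d₁) ℂ)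
    (B₂ : Matrix (Fin d₂) (Fin d₂) ℂ) (n : ℕ) (p : Fin d₁ × Fin d₁) (q : Fin d₂ × Fin d₂) :
    ((amp V₁ B₁ n)ᴴ * amp V₂ B₂ n) p q =
      (B₁ᴴ * (mixF V₁ V₂ ^ n) (Matrix.single p.1 q.1 1) * B₂) p.2 q.2 := by
  rw [mixF_pow, Matrix.mul_sum, Matrix.sum_mul, Matrix.sum_apply, Matrix.mul_apply]
  refine Finset.sum_congr rfl fun i _ => ?_
  have : B₁ᴴ * ((krausWord V₁ i)ᴴ * Matrix.single p.1 q.1 (1 : ℂ) * krausWord V₂ i) * B₂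
      = (krausWord V₁ i * B₁)ᴴ * Matrix.single p.1 q.1 (1 : ℂ) * (krausWord V₂ i * B₂) := by
    simp [Matrix.mul_assoc]
  rw [this, Matrix.mul_apply]
  simp [amp, conjTranspose_apply, Matrix.mul_apply, Matrix.single_apply,
    ite_and]
  exact Or.inl (Finset.sum_congr rfl fun _ _ => mul_comm _ _)

theorem exists_eigen {d₁ d₂ k : ℕ}
    (V₁ : Matrix (Fin d₁ × Fin k) (Fin d₁) ℂ) (ρ₁ : Matrix (Fin d₁) (Fin d₁) ℂ)
    (V₂ : Matrix (Fin d₂ × Fin k) (Fin d₂) ℂ) (ρ₂ : Matrix (Fin d₂) (Fin d₂) ℂ)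
    (h₁ : IsIrreducible V₁ ρ₁) (h₂ : IsIrreducible V₂ ρ₂)
    (h : OutputEquiv V₁ ρ₁ V₂ ρ₂) :
    ∃ μ : ℂ, 1 ≤ ‖μ‖ ∧ ∃ Y, Y ≠ 0 ∧ mixF V₁ V₂ Y = μ • Y := by
  by_contra hcon
  have hf : ∀ μ : ℂ, (mixF V₁ V₂).HasEigenvalue μ → ‖μ‖ < 1 := by
    intro μ hμ
    by_contra hlt
    obtain ⟨Y, hY⟩ := hμ.exists_hasEigenvector
    exact hcon ⟨μ, not_lt.1 hlt, Y, hY.2, hY.apply_eq_smul⟩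
  obtain ⟨B₁, hB₁⟩ := exists_factor h₁.2.1.1
  obtain ⟨B₂, hB₂⟩ := exists_factor h₂.2.1.1
  have hov : ∀ p q, Tendsto (fun n => ((amp V₁ B₁ n)ᴴ * amp V₂ B₂ n) p q) atTop (𝓝 0) := by
    intro p q
    simp only [amp_overlap]
    have hc : Continuous fun Y : Matrix (Fin d₁) (Fin d₂) ℂ => (B₁ᴴ * Y * B₂) p.2 q.2 :=
      (Continuous.matrix_mul (Continuous.matrix_mul continuous_const continuous_id)
        continuous_const).matrix_elem _ _
    have := (hc.tendsto 0).comp (mixF_tendsto V₁ V₂ hf (Matrix.single p.1 q.1 1))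
    simpa [Function.comp_def] using this
  have hsum : Tendsto (fun n => ∑ q, ∑ p, ‖((amp V₁ B₁ n)ᴴ * amp V₂ B₂ n) p q‖ ^ 2)
      atTop (𝓝 0) := by
    have := tendsto_finsetSum Finset.univ fun q (_ : q ∈ Finset.univ) =>
      tendsto_finsetSum Finset.univ fun p (_ : p ∈ Finset.univ) => ((hov p q).norm.pow 2)
    simpa using this
  have hG : ∀ p, Tendsto (fun n => ((amp V₁ B₁ n)ᴴ * amp V₁ B₁ n) p p) atTop (𝓝 0) := by
    intro p
    rw [tendsto_zero_iff_norm_tendsto_zero]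
    have h2 : Tendsto (fun n => ‖((amp V₁ B₁ n)ᴴ * amp V₁ B₁ n) p p‖ ^ 2) atTop (𝓝 0) := by
      refine squeeze_zero' (Eventually.of_forall fun n => by positivity) ?_ hsum
      filter_upwards [eventually_ge_atTop 1] with n hn
      refine purity _ _ ?_ p p
      ext i j
      rw [amp_out, amp_out, ← hB₁, ← hB₂]
      exact h n hn i j
    have h3 := h2.sqrt
    simpa [Real.sqrt_sq (norm_nonneg _)] using h3
  have hone : ∀ n, ∑ p, ((amp V₁ B₁ n)ᴴ * amp V₁ B₁ n) p p = 1 := by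
    intro n
    have e1 : ∑ p, ((amp V₁ B₁ n)ᴴ * amp V₁ B₁ n) p p
        = (amp V₁ B₁ n * (amp V₁ B₁ n)ᴴ).trace := by
      rw [Matrix.trace_mul_comm]; rfl
    have hfix : ∀ n, (mixF V₁ V₁ ^ n) 1 = 1 := by
      intro n
      induction n with
      | zero => simp
      | succ n ih =>
        rw [pow_succ', Module.End.mul_apply, ih, mixF_apply]
        simpa using sum_kraus h₁.1
    rw [e1]
    simp only [Matrix.trace, Matrix.diag, amp_out]
    rw [← hB₁]
    have e2 : ∀ i : Fin n → Fin k, (krausWord V₁ i * ρ₁ * (krausWord V₁ i)ᴴ).trace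
        = (((krausWord V₁ i)ᴴ * 1 * krausWord V₁ i) * ρ₁).trace := by
      intro i
      rw [Matrix.mul_one, Matrix.trace_mul_comm, Matrix.mul_assoc]
    change ∑ i : Fin n → Fin k, (krausWord V₁ i * ρ₁ * (krausWord V₁ i)ᴴ).trace = 1
    simp only [e2]
    rw [← Matrix.trace_sum, ← Matrix.sum_mul, ← mixF_pow, hfix, Matrix.one_mul]
    exact h₁.2.1.2
  have hz : Tendsto (fun n => ∑ p, ((amp V₁ B₁ n)ᴴ * amp V₁ B₁ n) p p) atTop (𝓝 0) := by
    simpa using tendsto_finsetSum Finset.univ fun p (_ : p ∈ Finset.univ) => hG p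
  simp only [hone] at hz
  exact one_ne_zero (tendsto_nhds_unique tendsto_const_nhds hz)

theorem intertwine {d₁ d₂ k : ℕ}
    {V₁ : Matrix (Fin d₁ × Fin k) (Fin d₁) ℂ}
    {V₂ : Matrix (Fin d₂ × Fin k) (Fin d₂) ℂ} {ρ₂ : Matrix (Fin d₂) (Fin d₂) ℂ}
    (h₁ : V₁ᴴ * V₁ = 1) (h₂ : IsIrreducible V₂ ρ₂)
    {μ : ℂ} (hμ : 1 ≤ ‖μ‖) {Y : Matrix (Fin d₁) (Fin d₂) ℂ} (hY : Y ≠ 0)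
    (hF : mixF V₁ V₂ Y = μ • Y) :
    ‖μ‖ = 1 ∧ ∀ j, Y * kraus V₂ j = μ • (kraus V₁ j * Y) := by
  set D : Fin k → Matrix (Fin d₁) (Fin d₂) ℂ :=
    fun j => Y * kraus V₂ j - μ • (kraus V₁ j * Y) with hD
  have hF' : ∑ j : Fin k, (kraus V₂ j)ᴴ * Yᴴ * kraus V₁ j = (star μ) • Yᴴ := by
    have := congrArg conjTranspose hF
    rw [mixF_apply, conjTranspose_sum, conjTranspose_smul] at this
    rw [← this]
    exact Finset.sum_congr rfl fun j _ => by simp [Matrix.mul_assoc]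
  have hsumD : ∑ j, (D j)ᴴ * D j =
      ∑ j, (kraus V₂ j)ᴴ * (Yᴴ * Y) * kraus V₂ j - (μ * star μ) • (Yᴴ * Y) := by
    have e : ∀ j, (D j)ᴴ * D j = (kraus V₂ j)ᴴ * (Yᴴ * Y) * kraus V₂ j
        - μ • (((kraus V₂ j)ᴴ * Yᴴ * kraus V₁ j) * Y)
        - star μ • (Yᴴ * ((kraus V₁ j)ᴴ * Y * kraus V₂ j))
        + (μ * star μ) • (Yᴴ * ((kraus V₁ j)ᴴ * kraus V₁ j) * Y) := by
      intro j
      simp only [hD, conjTranspose_sub, conjTranspose_smul, conjTranspose_mul, Matrix.sub_mul,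
        Matrix.mul_sub, Matrix.smul_mul, Matrix.mul_smul, smul_sub, smul_smul, Matrix.mul_assoc]
      abel
    simp only [e, Finset.sum_add_distrib, Finset.sum_sub_distrib, ← Finset.smul_sum,
      ← Matrix.sum_mul, ← Matrix.mul_sum]
    rw [hF', ← mixF_apply V₁ V₂ Y, hF, sum_kraus h₁]
    simp only [Matrix.mul_one, Matrix.smul_mul, Matrix.mul_smul, smul_smul]
    rw [mul_comm (star μ) μ]
    abel
  have hcyc : ∀ X : Matrix (Fin d₁) (Fin d₂) ℂ, (X * ρ₂ * Xᴴ).trace = (Xᴴ * X * ρ₂).trace := by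
    intro X
    rw [Matrix.trace_mul_comm, Matrix.mul_assoc]
  have htr : ∑ j, (D j * ρ₂ * (D j)ᴴ).trace
      = ((1 - ‖μ‖ ^ 2 : ℝ) : ℂ) * (Y * ρ₂ * Yᴴ).trace := by
    simp only [hcyc]
    rw [← Matrix.trace_sum, ← Matrix.sum_mul, hsumD, Matrix.sub_mul, Matrix.trace_sub]
    have e3 : ((∑ j, (kraus V₂ j)ᴴ * (Yᴴ * Y) * kraus V₂ j) * ρ₂).trace = (Yᴴ * Y * ρ₂).trace := by
      conv_rhs => rw [← h₂.2.2.1, predual]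
      rw [Matrix.sum_mul, Matrix.mul_sum, Matrix.trace_sum, Matrix.trace_sum]
      refine Finset.sum_congr rfl fun j _ => ?_
      rw [Matrix.mul_assoc, Matrix.mul_assoc, Matrix.trace_mul_comm]
      simp only [Matrix.mul_assoc]
    rw [e3, Matrix.smul_mul, Matrix.trace_smul, Complex.star_def, Complex.mul_conj']
    push_cast
    rw [smul_eq_mul]; ring
  have hpos : 0 ≤ (Y * ρ₂ * Yᴴ).trace := trace_sandwich_nonneg h₂.2.1.1 Y
  have hne : (Y * ρ₂ * Yᴴ).trace ≠ 0 := fun h0 => hY (sandwich_eq_zero h₂.2.2.2.1 Y h0)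
  have hDn : ∀ j, 0 ≤ (D j * ρ₂ * (D j)ᴴ).trace := fun j => trace_sandwich_nonneg h₂.2.1.1 _
  have hle : ∑ j, (D j * ρ₂ * (D j)ᴴ).trace ≤ 0 := by
    rw [htr]
    refine mul_nonpos_of_nonpos_of_nonneg ?_ hpos
    have : (1 - ‖μ‖ ^ 2 : ℝ) ≤ 0 := by nlinarith
    exact_mod_cast this
  have hz : ∑ j, (D j * ρ₂ * (D j)ᴴ).trace = 0 :=
    le_antisymm hle (Finset.sum_nonneg fun j _ => hDn j)
  constructor
  · rw [hz] at htr
    have := (mul_eq_zero.1 htr.symm).resolve_right hne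
    have h4 : (1 - ‖μ‖ ^ 2 : ℝ) = 0 := by exact_mod_cast this
    nlinarith [norm_nonneg μ]
  · intro j
    have := (Finset.sum_eq_zero_iff_of_nonneg fun j _ => hDn j).1 hz j (Finset.mem_univ j)
    exact sub_eq_zero.1 (sandwich_eq_zero h₂.2.2.2.1 (D j) this)

theorem dim_pos {d k : ℕ} {V : Matrix (Fin d × Fin k) (Fin d) ℂ}
    {ρ : Matrix (Fin d) (Fin d) ℂ} (h : IsIrreducible V ρ) : 0 < d := by
  rcases Nat.eq_zero_or_pos d with rfl | hd
  · have := h.2.1.2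
    simp [Matrix.trace] at this
  · exact hd

theorem scalar_of_commute {d k : ℕ} {V : Matrix (Fin d × Fin k) (Fin d) ℂ}
    {ρ : Matrix (Fin d) (Fin d) ℂ} (h : IsIrreducible V ρ) (Z : Matrix (Fin d) (Fin d) ℂ)
    (hZ : ∀ j, Z * kraus V j = kraus V j * Z) : ∃ c : ℂ, Z = c • 1 := by
  have : NeZero d := ⟨(dim_pos h).ne'⟩
  obtain ⟨c, hc⟩ := Module.End.exists_eigenvalue (Matrix.toLin' Z)
  obtain ⟨v, hv⟩ := hc.exists_hasEigenvector
  refine ⟨c, ?_⟩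
  have hv1 : Z *ᵥ v = c • v := by simpa using hv.apply_eq_smul
  have hv0 : v ≠ 0 := hv.2
  set N := Z - c • (1 : Matrix (Fin d) (Fin d) ℂ) with hN
  have hNv : N *ᵥ v = 0 := by
    rw [hN, Matrix.sub_mulVec, hv1, Matrix.smul_mulVec, Matrix.one_mulVec, sub_self]
  have hNK : ∀ j, kraus V j * N = N * kraus V j := by
    intro j
    simp [hN, Matrix.mul_sub, Matrix.sub_mul, hZ j]
  have hdet : N.det = 0 := Matrix.exists_mulVec_eq_zero_iff.1 ⟨v, hv0, hNv⟩
  suffices N = 0 from sub_eq_zero.1 this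
  by_contra hN0
  set t := (N * ρ * Nᴴ).trace with ht
  have htne : t ≠ 0 := fun h0 => hN0 (sandwich_eq_zero h.2.2.2.1 N h0)
  have htpos : 0 ≤ t := trace_sandwich_nonneg h.2.1.1 N
  have hst : t⁻¹ • (N * ρ * Nᴴ) = ρ := by
    refine h.2.2.2.2 _ ⟨?_, ?_⟩ ?_
    · exact (h.2.1.1.mul_mul_conjTranspose_same N).smul (inv_nonneg_of_nonneg htpos)
    · rw [Matrix.trace_smul, ← ht, smul_eq_mul, inv_mul_cancel₀ htne]
    · conv_rhs => rw [← h.2.2.1]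
      simp only [predual, Matrix.mul_smul, Matrix.smul_mul, ← Finset.smul_sum]
      congr 1
      rw [Matrix.mul_sum, Matrix.sum_mul]
      refine Finset.sum_congr rfl fun j _ => ?_
      have e := congrArg conjTranspose (hNK j)
      rw [conjTranspose_mul, conjTranspose_mul] at e
      calc kraus V j * (N * ρ * Nᴴ) * (kraus V j)ᴴ
          = (kraus V j * N) * ρ * (Nᴴ * (kraus V j)ᴴ) := by simp only [Matrix.mul_assoc]
        _ = _ := by rw [e, hNK]; simp only [Matrix.mul_assoc]
  have hu : IsUnit ρ.det := (Matrix.isUnit_iff_isUnit_det _).1 h.2.2.2.1.isUnit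
  rw [← hst] at hu
  simp [Matrix.det_smul, Matrix.det_mul, hdet, (dim_pos h).ne'] at hu

theorem main_forward {d₁ d₂ k : ℕ}
    (V₁ : Matrix (Fin d₁ × Fin k) (Fin d₁) ℂ) (ρ₁ : Matrix (Fin d₁) (Fin d₁) ℂ)
    (V₂ : Matrix (Fin d₂ × Fin k) (Fin d₂) ℂ) (ρ₂ : Matrix (Fin d₂) (Fin d₂) ℂ)
    (h₁ : IsIrreducible V₁ ρ₁) (h₂ : IsIrreducible V₂ ρ₂)
    (h : OutputEquiv V₁ ρ₁ V₂ ρ₂) :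
    d₁ = d₂ ∧ ∃ (W : Matrix (Fin d₁) (Fin d₂) ℂ) (ω : ℝ), IsUnitaryMat W ∧
      ∀ j, W * kraus V₂ j = Complex.exp (ω * Complex.I) • (kraus V₁ j * W) := by
  obtain ⟨μ, hμ, Y, hY, hF⟩ := exists_eigen V₁ ρ₁ V₂ ρ₂ h₁ h₂ h
  obtain ⟨hμ1, hcomm⟩ := intertwine h₁.1 h₂ hμ hY hF
  have hF' : mixF V₂ V₁ Yᴴ = (star μ) • Yᴴ := by
    have := congrArg conjTranspose hF
    rw [mixF_apply, conjTranspose_sum, conjTranspose_smul] at this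
    rw [← this, mixF_apply]
    exact Finset.sum_congr rfl fun j _ => by simp [Matrix.mul_assoc]
  have hY' : Yᴴ ≠ 0 := by simpa using hY
  obtain ⟨-, hcomm'⟩ := intertwine h₂.1 h₁ (μ := star μ) (by simpa using hμ) hY' hF'
  have hμμ : μ * star μ = 1 := by
    rw [Complex.star_def, Complex.mul_conj', hμ1]; simp
  obtain ⟨c, hc⟩ := scalar_of_commute h₂ (Yᴴ * Y) (fun j => by
    rw [Matrix.mul_assoc, hcomm, Matrix.mul_smul, ← Matrix.mul_assoc, hcomm', Matrix.smul_mul,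
      smul_smul, hμμ, one_smul, Matrix.mul_assoc])
  obtain ⟨c', hc'⟩ := scalar_of_commute h₁ (Y * Yᴴ) (fun j => by
    rw [Matrix.mul_assoc, hcomm', Matrix.mul_smul, ← Matrix.mul_assoc, hcomm, Matrix.smul_mul,
      smul_smul, mul_comm, hμμ, one_smul, Matrix.mul_assoc])
  have hcc : c = c' := by
    have e : c • Y = c' • Y := by
      calc c • Y = Y * (Yᴴ * Y) := by rw [hc, Matrix.mul_smul, Matrix.mul_one]
        _ = (Y * Yᴴ) * Y := by rw [Matrix.mul_assoc]
        _ = c' • Y := by rw [hc', Matrix.smul_mul, Matrix.one_mul]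
    exact smul_left_injective ℂ hY e
  subst hcc
  have hc0 : 0 ≤ c := by
    have := (posSemidef_conjTranspose_mul_self Y).diag_nonneg (i := ⟨0, dim_pos h₂⟩)
    rw [hc] at this
    simpa using this
  have hcne : c ≠ 0 := by
    rintro rfl
    rw [zero_smul] at hc
    exact hY (Matrix.conjTranspose_mul_self_eq_zero.1 hc)
  obtain ⟨r, hr, rfl⟩ : ∃ r : ℝ, 0 < r ∧ c = (r : ℂ) := by
    have hp : 0 < c := lt_of_le_of_ne hc0 hcne.symm
    obtain ⟨h1, h2⟩ := Complex.pos_iff.1 hp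
    exact ⟨c.re, h1, Complex.ext rfl (by simp [← h2])⟩
  set s : ℂ := (((Real.sqrt r)⁻¹ : ℝ) : ℂ) with hs
  have hss : s * s * (r : ℂ) = 1 := by
    rw [hs, ← Complex.ofReal_mul, ← Complex.ofReal_mul, ← mul_inv, Real.mul_self_sqrt hr.le,
      inv_mul_cancel₀ hr.ne', Complex.ofReal_one]
  have hstar : star s = s := by rw [hs, Complex.star_def, Complex.conj_ofReal]
  have hU : IsUnitaryMat (s • Y) := by
    constructor
    · rw [conjTranspose_smul, hstar, Matrix.smul_mul, Matrix.mul_smul, hc, smul_smul, smul_smul,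
        hss, one_smul]
    · rw [conjTranspose_smul, hstar, Matrix.smul_mul, Matrix.mul_smul, hc', smul_smul, smul_smul,
        hss, one_smul]
  refine ⟨?_, s • Y, μ.arg, hU, ?_⟩
  · have e := Matrix.trace_mul_comm (s • Y) (s • Y)ᴴ
    rw [hU.1, hU.2] at e
    simpa using e
  · intro j
    have : Complex.exp (μ.arg * Complex.I) = μ := by
      have := Complex.norm_mul_exp_arg_mul_I μ
      rwa [hμ1, Complex.ofReal_one, one_mul] at this
    rw [this, Matrix.smul_mul, hcomm, Matrix.mul_smul, smul_comm]

theorem blocks_iff {d₁ d₂ k : ℕ}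
    (V₁ : Matrix (Fin d₁ × Fin k) (Fin d₁) ℂ)
    (V₂ : Matrix (Fin d₂ × Fin k) (Fin d₂) ℂ) (W : Matrix (Fin d₁) (Fin d₂) ℂ) (z : ℂ) :
    (W ⊗ₖ (1 : Matrix (Fin k) (Fin k) ℂ)) * V₂ = z • (V₁ * W) ↔
      ∀ j, W * kraus V₂ j = z • (kraus V₁ j * W) := by
  have e1 : ∀ a j b, ((W ⊗ₖ (1 : Matrix (Fin k) (Fin k) ℂ)) * V₂) (a, j) b
      = (W * kraus V₂ j) a b := by
    intro a j b
    simp [Matrix.mul_apply, Fintype.sum_prod_type, Matrix.one_apply, kraus, blk]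
  have e2 : ∀ a j b, (z • (V₁ * W)) (a, j) b = (z • (kraus V₁ j * W)) a b := by
    intro a j b
    simp [Matrix.mul_apply, kraus, blk]
  constructor
  · intro h j
    ext a b
    rw [← e1, ← e2, h]
  · intro h
    ext ⟨a, j⟩ b
    rw [e1, e2, h]

theorem word_conj {d₁ d₂ k : ℕ}
    (V₁ : Matrix (Fin d₁ × Fin k) (Fin d₁) ℂ)
    (V₂ : Matrix (Fin d₂ × Fin k) (Fin d₂) ℂ) (W : Matrix (Fin d₁) (Fin d₂) ℂ) (z : ℂ)
    (h : ∀ j, W * kraus V₂ j = z • (kraus V₁ j * W)) (n : ℕ) (i : Fin n → Fin k) :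
    W * krausWord V₂ i = z ^ n • (krausWord V₁ i * W) := by
  induction n with
  | zero => simp [krausWord]
  | succ n ih =>
    rw [← Fin.cons_self_tail i, krausWord_cons, krausWord_cons, ← Matrix.mul_assoc, ih,
      Matrix.smul_mul, Matrix.mul_assoc, h, Matrix.mul_smul, smul_smul, Matrix.mul_assoc, pow_succ]

theorem exp_star (ω : ℝ) :
    Complex.exp (ω * Complex.I) * star (Complex.exp (ω * Complex.I)) = 1 := by
  rw [Complex.star_def, Complex.mul_conj', Complex.norm_exp_ofReal_mul_I]; simp

theorem main_state {d₁ d₂ k : ℕ}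
    (V₁ : Matrix (Fin d₁ × Fin k) (Fin d₁) ℂ) (ρ₁ : Matrix (Fin d₁) (Fin d₁) ℂ)
    (V₂ : Matrix (Fin d₂ × Fin k) (Fin d₂) ℂ) (ρ₂ : Matrix (Fin d₂) (Fin d₂) ℂ)
    (h₁ : IsIrreducible V₁ ρ₁) (h₂ : IsIrreducible V₂ ρ₂)
    (W : Matrix (Fin d₁) (Fin d₂) ℂ) (ω : ℝ) (hW : IsUnitaryMat W)
    (h : ∀ j, kraus V₂ j = Complex.exp (ω * Complex.I) • (Wᴴ * kraus V₁ j * W)) :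
    ρ₂ = Wᴴ * ρ₁ * W := by
  symm
  refine h₂.2.2.2.2 _ ⟨h₁.2.1.1.conjTranspose_mul_mul_same W, ?_⟩ ?_
  · rw [Matrix.mul_assoc, Matrix.trace_mul_comm, Matrix.mul_assoc, hW.2, Matrix.mul_one]
    exact h₁.2.1.2
  · conv_rhs => rw [← h₁.2.2.1]
    simp only [predual]
    rw [Matrix.mul_sum, Matrix.sum_mul]
    refine Finset.sum_congr rfl fun j _ => ?_
    rw [h j]
    simp only [conjTranspose_smul, Matrix.smul_mul, Matrix.mul_smul, smul_smul, conjTranspose_mul,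
      conjTranspose_conjTranspose]
    rw [mul_comm, exp_star, one_smul]
    calc Wᴴ * kraus V₁ j * W * (Wᴴ * ρ₁ * W) * (Wᴴ * ((kraus V₁ j)ᴴ * W))
        = Wᴴ * kraus V₁ j * (W * Wᴴ) * ρ₁ * (W * Wᴴ) * (kraus V₁ j)ᴴ * W := by
          simp only [Matrix.mul_assoc]
      _ = _ := by rw [hW.2]; simp only [Matrix.mul_assoc, Matrix.mul_one, Matrix.one_mul]

theorem main_back {d₁ d₂ k : ℕ}
    (V₁ : Matrix (Fin d₁ × Fin k) (Fin d₁) ℂ) (ρ₁ : Matrix (Fin d₁) (Fin d₁) ℂ)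
    (V₂ : Matrix (Fin d₂ × Fin k) (Fin d₂) ℂ) (ρ₂ : Matrix (Fin d₂) (Fin d₂) ℂ)
    (W : Matrix (Fin d₁) (Fin d₂) ℂ) (ω : ℝ) (hW : IsUnitaryMat W)
    (h : ∀ j, W * kraus V₂ j = Complex.exp (ω * Complex.I) • (kraus V₁ j * W))
    (hρ : ρ₂ = Wᴴ * ρ₁ * W) : OutputEquiv V₁ ρ₁ V₂ ρ₂ := by
  intro n _ i j
  have hi := word_conj V₁ V₂ W _ h n i
  have hj := word_conj V₁ V₂ W _ h n j
  set z := Complex.exp (ω * Complex.I) with hz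
  have hzn : z ^ n * star (z ^ n) = 1 := by
    rw [star_pow, ← mul_pow, hz, exp_star, one_pow]
  have key : ∀ i : Fin n → Fin k, W * krausWord V₂ i * Wᴴ = z ^ n • krausWord V₁ i := by
    intro i
    rw [word_conj V₁ V₂ W _ h n i, Matrix.smul_mul, Matrix.mul_assoc, hW.2, Matrix.mul_one]
  have e : W * (krausWord V₂ i * ρ₂ * (krausWord V₂ j)ᴴ) * Wᴴ
      = krausWord V₁ i * ρ₁ * (krausWord V₁ j)ᴴ := by
    calc W * (krausWord V₂ i * ρ₂ * (krausWord V₂ j)ᴴ) * Wᴴ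
        = (W * krausWord V₂ i * Wᴴ) * ρ₁ * (W * krausWord V₂ j * Wᴴ)ᴴ := by
          rw [hρ]
          simp only [conjTranspose_mul, conjTranspose_conjTranspose, Matrix.mul_assoc]
      _ = _ := by
          rw [key, key, conjTranspose_smul]
          simp only [Matrix.smul_mul, Matrix.mul_smul, smul_smul]
          rw [mul_comm, hzn, one_smul]
  rw [← e, Matrix.trace_mul_comm, ← Matrix.mul_assoc, hW.1, Matrix.one_mul]

theorem conj_iff {d₁ d₂ : ℕ} {W : Matrix (Fin d₁) (Fin d₂) ℂ} (hW : IsUnitaryMat W) (z : ℂ)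
    (A : Matrix (Fin d₁) (Fin d₁) ℂ) (B : Matrix (Fin d₂) (Fin d₂) ℂ) :
    B = z • (Wᴴ * A * W) ↔ W * B = z • (A * W) := by
  constructor
  · rintro rfl
    rw [Matrix.mul_smul, ← Matrix.mul_assoc, ← Matrix.mul_assoc, hW.2, Matrix.one_mul]
  · intro h
    rw [Matrix.mul_assoc, ← Matrix.mul_smul, ← h, ← Matrix.mul_assoc, hW.1, Matrix.one_mul]

/-- Theorem: equivalent irreducible QMCs.
Two irreducible QMCs are output equivalent iff they are related by a phase and a
unitary conjugation, equivalently iff the defining isometries are intertwined by a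
unitary up to a phase. -/
theorem output_equivalence_characterisation {d₁ d₂ k : ℕ}
    (V₁ : Matrix (Fin d₁ × Fin k) (Fin d₁) ℂ) (ρ₁ : Matrix (Fin d₁) (Fin d₁) ℂ)
    (V₂ : Matrix (Fin d₂ × Fin k) (Fin d₂) ℂ) (ρ₂ : Matrix (Fin d₂) (Fin d₂) ℂ)
    (h₁ : IsIrreducible V₁ ρ₁) (h₂ : IsIrreducible V₂ ρ₂) :
    (OutputEquiv V₁ ρ₁ V₂ ρ₂ ↔
      d₁ = d₂ ∧ ∃ (W : Matrix (Fin d₁) (Fin d₂) ℂ) (ω : ℝ), IsUnitaryMat W ∧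
        (∀ j : Fin k, kraus V₂ j = Complex.exp (ω * Complex.I) • (Wᴴ * kraus V₁ j * W)) ∧
        ρ₂ = Wᴴ * ρ₁ * W) ∧
    (OutputEquiv V₁ ρ₁ V₂ ρ₂ ↔
      d₁ = d₂ ∧ ∃ (W : Matrix (Fin d₁) (Fin d₂) ℂ) (ω : ℝ), IsUnitaryMat W ∧
        (W ⊗ₖ (1 : Matrix (Fin k) (Fin k) ℂ)) * V₂
          = Complex.exp (ω * Complex.I) • (V₁ * W)) := by
  refine ⟨⟨fun h => ?_, ?_⟩, ⟨fun h => ?_, ?_⟩⟩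
  · obtain ⟨hd, W, ω, hW, hj⟩ := main_forward V₁ ρ₁ V₂ ρ₂ h₁ h₂ h
    have hk := fun j => (conj_iff hW _ _ _).2 (hj j)
    exact ⟨hd, W, ω, hW, hk, main_state V₁ ρ₁ V₂ ρ₂ h₁ h₂ W ω hW hk⟩
  · rintro ⟨-, W, ω, hW, hk, hρ⟩
    exact main_back V₁ ρ₁ V₂ ρ₂ W ω hW (fun j => (conj_iff hW _ _ _).1 (hk j)) hρ
  · obtain ⟨hd, W, ω, hW, hj⟩ := main_forward V₁ ρ₁ V₂ ρ₂ h₁ h₂ h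
    exact ⟨hd, W, ω, hW, (blocks_iff V₁ V₂ W _).2 hj⟩
  · rintro ⟨-, W, ω, hW, hb⟩
    have hj := (blocks_iff V₁ V₂ W _).1 hb
    have hk := fun j => (conj_iff hW _ _ _).2 (hj j)
    exact main_back V₁ ρ₁ V₂ ρ₂ W ω hW hj (main_state V₁ ρ₁ V₂ ρ₂ h₁ h₂ W ω hW hk)

end QMCPaper
end
end

section
/- Let V be an isometry defining an irreducible quantum Markov chain with system dimension d and environment dimension k, with stationary state ρˢˢ. Then every (d·k)×d complex matrix L satisfying the tangency condition LᴴV = VᴴL decomposes uniquely as L = θ V − (K ⊗ 1_k) V + V K + L₀, where θ ∈ ℝ, K is a Hermitian d×d matrix with tr(ρˢˢ K) = 0, and L₀ is a (d·k)×d matrix with V Vᴴ L₀ = 0. (That is, the tangent space at V to the manifold of isometries splits as the direct sum of the non-identifiable directions, which are parametrized bijectively by (θ, K), and the identifiable directions {L₀ : VVᴴL₀ = 0}.) -/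
open Matrix Filter
open scoped Kronecker ComplexConjugate ComplexOrder

noncomputable section

namespace QMCPaper

theorem chan_eq {d k : ℕ} (V : Matrix (Fin d × Fin k) (Fin d) ℂ)
    (X : Matrix (Fin d) (Fin d) ℂ) :
    Vᴴ * ((X ⊗ₖ (1 : Matrix (Fin k) (Fin k) ℂ)) * V) = chan V X := by
  ext a b
  simp only [chan, kraus, Matrix.sum_apply, Matrix.mul_assoc]
  simp only [Matrix.mul_apply, Fintype.sum_prod_type, kroneckerMap_apply,
    conjTranspose_apply, blk, Matrix.one_apply, mul_ite, mul_one, mul_zero, ite_mul, zero_mul,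
    Finset.sum_ite_eq, Finset.mem_univ, if_true]
  rw [Finset.sum_comm]

theorem sum_kraus_s8 {d k : ℕ} (V : Matrix (Fin d × Fin k) (Fin d) ℂ) (hV : Vᴴ * V = 1) :
    chan V 1 = 1 := by
  rw [← chan_eq, Matrix.one_kronecker_one, Matrix.one_mul, hV]

theorem trace_chan {d k : ℕ} (V : Matrix (Fin d × Fin k) (Fin d) ℂ)
    (ρ X : Matrix (Fin d) (Fin d) ℂ) :
    (ρ * chan V X).trace = (predual V ρ * X).trace := by
  simp only [chan, predual, Matrix.mul_sum, Matrix.sum_mul, Matrix.trace_sum]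
  refine Finset.sum_congr rfl fun j _ => ?_
  rw [← Matrix.mul_assoc, Matrix.trace_mul_comm]
  simp only [Matrix.mul_assoc]

theorem zero_of_trace {d : ℕ} {ρ N : Matrix (Fin d) (Fin d) ℂ} (hρ : ρ.PosDef)
    (h : (N * ρ * Nᴴ).trace = 0) : N = 0 := by
  have h0 : N * ρ * Nᴴ = 0 :=
    (hρ.posSemidef.mul_mul_conjTranspose_same N).trace_eq_zero_iff.1 h
  by_contra hN
  have : Nᴴ ≠ 0 := by simpa using hN
  apply this
  rw [← Matrix.mulVec_injective.eq_iff]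
  funext v
  rw [Matrix.zero_mulVec]
  by_contra hv
  have := hρ.dotProduct_mulVec_pos hv
  apply this.ne'
  rw [Matrix.star_mulVec, Matrix.conjTranspose_conjTranspose, Matrix.mulVec_mulVec,
    Matrix.dotProduct_mulVec, Matrix.vecMul_vecMul, ← Matrix.mul_assoc, h0]
  simp

theorem trace_nonneg' {d : ℕ} {ρ N : Matrix (Fin d) (Fin d) ℂ} (hρ : ρ.PosDef) :
    0 ≤ (N * ρ * Nᴴ).trace :=
  (hρ.posSemidef.mul_mul_conjTranspose_same N).trace_nonneg

theorem chan_conj {d k : ℕ} (V : Matrix (Fin d × Fin k) (Fin d) ℂ)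
    (X : Matrix (Fin d) (Fin d) ℂ) : (chan V X)ᴴ = chan V Xᴴ := by
  simp [chan, Matrix.conjTranspose_sum, Matrix.mul_assoc]

theorem commute_of_fixed {d k : ℕ} (V : Matrix (Fin d × Fin k) (Fin d) ℂ)
    (ρss : Matrix (Fin d) (Fin d) ℂ) (h : IsIrreducible V ρss)
    (X : Matrix (Fin d) (Fin d) ℂ) (hX : chan V X = X) (j : Fin k) :
    X * kraus V j = kraus V j * X := by
  obtain ⟨hV, -, hst, hpd, -⟩ := h
  have h1 := sum_kraus_s8 V hV
  have key : ∑ j, (X * kraus V j - kraus V j * X)ᴴ * (X * kraus V j - kraus V j * X)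
      = chan V (Xᴴ * X) - Xᴴ * X := by
    have e : ∀ j, (X * kraus V j - kraus V j * X)ᴴ * (X * kraus V j - kraus V j * X)
      = (kraus V j)ᴴ * (Xᴴ * X) * kraus V j - (kraus V j)ᴴ * Xᴴ * kraus V j * X
        - Xᴴ * ((kraus V j)ᴴ * X * kraus V j) + Xᴴ * ((kraus V j)ᴴ * 1 * kraus V j) * X := by
      intro j
      simp only [conjTranspose_sub, conjTranspose_mul]
      noncomm_ring
    simp only [e, Finset.sum_add_distrib, Finset.sum_sub_distrib, ← Finset.mul_sum,
      ← Finset.sum_mul]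
    change chan V (Xᴴ * X) - chan V Xᴴ * X - Xᴴ * chan V X + Xᴴ * chan V 1 * X = _
    rw [← chan_conj, hX, h1]
    noncomm_ring
  have ht : ∑ j, ((X * kraus V j - kraus V j * X) * ρss * (X * kraus V j - kraus V j * X)ᴴ).trace
      = 0 := by
    have : (ρss * (chan V (Xᴴ * X) - Xᴴ * X)).trace = 0 := by
      rw [Matrix.mul_sub, Matrix.trace_sub, trace_chan, hst, sub_self]
    rw [← key, Matrix.mul_sum, Matrix.trace_sum] at this
    rw [← this]
    refine Finset.sum_congr rfl fun j _ => ?_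
    rw [Matrix.mul_assoc, Matrix.trace_mul_comm, Matrix.mul_assoc]
  rw [Finset.sum_eq_zero_iff_of_nonneg (fun j _ => trace_nonneg' hpd)] at ht
  exact sub_eq_zero.1 (zero_of_trace hpd (ht j (Finset.mem_univ _)))

theorem scalar_of_fixed {d k : ℕ} (V : Matrix (Fin d × Fin k) (Fin d) ℂ)
    (ρss : Matrix (Fin d) (Fin d) ℂ) (h : IsIrreducible V ρss)
    (X : Matrix (Fin d) (Fin d) ℂ) (hX : chan V X = X) :
    ∃ c : ℂ, X = c • (1 : Matrix (Fin d) (Fin d) ℂ) := by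
  have hc := commute_of_fixed V ρss h X hX
  obtain ⟨hV, hs, hst, hpd, huniq⟩ := h
  have hd : Nonempty (Fin d) := by
    by_contra hne
    rw [not_nonempty_iff] at hne
    have := hs.2
    simp [Matrix.trace] at this
  obtain ⟨c, hcs⟩ := spectrum.nonempty_of_isAlgClosed_of_finiteDimensional ℂ X
  refine ⟨c, ?_⟩
  set N := X - c • (1 : Matrix (Fin d) (Fin d) ℂ) with hN
  have hdet : N.det = 0 := by
    rw [spectrum.mem_iff, Matrix.isUnit_iff_isUnit_det, isUnit_iff_ne_zero, not_not,
      Algebra.algebraMap_eq_smul_one, ← neg_sub, Matrix.det_neg] at hcs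
    simpa using hcs
  have hNc : ∀ j, kraus V j * N = N * kraus V j := by
    intro j
    simp [hN, Matrix.mul_sub, Matrix.sub_mul, hc j]
  have hNc' : ∀ j, Nᴴ * (kraus V j)ᴴ = (kraus V j)ᴴ * Nᴴ := by
    intro j
    rw [← conjTranspose_mul, hNc, conjTranspose_mul]
  have hfix : predual V (N * ρss * Nᴴ) = N * ρss * Nᴴ := by
    conv_rhs => rw [← hst]
    simp only [predual, Matrix.mul_sum, Matrix.sum_mul]
    refine Finset.sum_congr rfl fun j _ => ?_
    simp only [Matrix.mul_assoc, hNc']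
    simp only [← Matrix.mul_assoc, hNc]
  have hps := hpd.posSemidef.mul_mul_conjTranspose_same N
  suffices N = 0 from sub_eq_zero.1 this
  apply zero_of_trace hpd
  by_contra ht
  set t := (N * ρss * Nᴴ).trace with htdef
  have ht0 : 0 ≤ t := trace_nonneg' hpd
  have := huniq (t⁻¹ • (N * ρss * Nᴴ)) ⟨hps.smul (inv_nonneg.2 ht0), by
    rw [Matrix.trace_smul, ← htdef, smul_eq_mul, inv_mul_cancel₀ ht]⟩ (by
    conv_rhs => rw [← hfix]
    simp [predual, Finset.smul_sum])
  have hdρ := hpd.det_pos.ne'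
  rw [← this] at hdρ
  apply hdρ
  simp [Matrix.det_smul, hdet]

/-- The linear map `K ↦ K - T(K) + tr(ρ K) 1`. -/
def auxMap {d k : ℕ} (V : Matrix (Fin d × Fin k) (Fin d) ℂ)
    (ρ : Matrix (Fin d) (Fin d) ℂ) :
    Matrix (Fin d) (Fin d) ℂ →ₗ[ℂ] Matrix (Fin d) (Fin d) ℂ where
  toFun X := X - chan V X + (ρ * X).trace • 1
  map_add' X Y := by
    simp only [chan, Matrix.mul_add, Matrix.add_mul, Finset.sum_add_distrib, Matrix.trace_add,
      add_smul]
    abel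
  map_smul' c X := by
    simp [chan, ← Finset.smul_sum, smul_sub, smul_smul]

theorem auxMap_apply {d k : ℕ} (V : Matrix (Fin d × Fin k) (Fin d) ℂ)
    (ρ X : Matrix (Fin d) (Fin d) ℂ) :
    auxMap V ρ X = X - chan V X + (ρ * X).trace • 1 := rfl

theorem trace_auxMap {d k : ℕ} (V : Matrix (Fin d × Fin k) (Fin d) ℂ)
    (ρss : Matrix (Fin d) (Fin d) ℂ) (h : IsIrreducible V ρss) (X : Matrix (Fin d) (Fin d) ℂ) :
    (ρss * auxMap V ρss X).trace = (ρss * X).trace := by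
  rw [auxMap_apply, Matrix.mul_add, Matrix.mul_sub, Matrix.trace_add, Matrix.trace_sub,
    trace_chan, h.2.2.1, sub_self, zero_add, Matrix.mul_smul, Matrix.trace_smul, Matrix.mul_one,
    h.2.1.2, smul_eq_mul, mul_one]

theorem auxMap_injective {d k : ℕ} (V : Matrix (Fin d × Fin k) (Fin d) ℂ)
    (ρss : Matrix (Fin d) (Fin d) ℂ) (h : IsIrreducible V ρss) :
    Function.Injective (auxMap V ρss) := by
  rw [injective_iff_map_eq_zero]
  intro X hX
  have h1 := trace_auxMap V ρss h X
  rw [hX, Matrix.mul_zero, Matrix.trace_zero] at h1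
  rw [auxMap_apply, ← h1, zero_smul, add_zero, sub_eq_zero] at hX
  obtain ⟨c, rfl⟩ := scalar_of_fixed V ρss h X hX.symm
  rw [Matrix.mul_smul, Matrix.trace_smul, Matrix.mul_one, h.2.1.2, smul_eq_mul, mul_one] at h1
  rw [← h1, zero_smul]

/-- Proposition: splitting of the tangent space at `V` into
non-identifiable and identifiable directions. -/
theorem tangent_space_splitting {d k : ℕ}
    (V : Matrix (Fin d × Fin k) (Fin d) ℂ) (ρss : Matrix (Fin d) (Fin d) ℂ)
    (h : IsIrreducible V ρss) :
    ∀ L : Matrix (Fin d × Fin k) (Fin d) ℂ, Lᴴ * V = Vᴴ * L →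
      ∃! t : ℝ × Matrix (Fin d) (Fin d) ℂ × Matrix (Fin d × Fin k) (Fin d) ℂ,
        (t.2.1.IsHermitian ∧ (ρss * t.2.1).trace = 0 ∧ V * Vᴴ * t.2.2 = 0) ∧
        L = (t.1 : ℂ) • V - (t.2.1 ⊗ₖ (1 : Matrix (Fin k) (Fin k) ℂ)) * V
              + V * t.2.1 + t.2.2 := by
  intro L hL
  have hV := h.1
  have hinj := auxMap_injective V ρss h
  have hρH : ρssᴴ = ρss := h.2.2.2.1.isHermitian
  have hMH : (Vᴴ * L)ᴴ = Vᴴ * L := by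
    rw [conjTranspose_mul, conjTranspose_conjTranspose, hL]
  have htr : ∀ A : Matrix (Fin d) (Fin d) ℂ, star (ρss * A).trace = (ρss * Aᴴ).trace := by
    intro A
    rw [← Matrix.trace_conjTranspose, conjTranspose_mul, hρH, Matrix.trace_mul_comm]
  have hθ : (((ρss * (Vᴴ * L)).trace.re : ℝ) : ℂ) = (ρss * (Vᴴ * L)).trace := by
    rw [← Complex.conj_eq_iff_re]
    have := htr (Vᴴ * L)
    rwa [hMH] at this
  set θ : ℝ := (ρss * (Vᴴ * L)).trace.re with hθdef
  obtain ⟨K, hK⟩ := (LinearMap.injective_iff_surjective.1 hinj) (Vᴴ * L - (θ : ℂ) • 1)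
  have hK0 : (ρss * K).trace = 0 := by
    rw [← trace_auxMap V ρss h, hK, Matrix.mul_sub, Matrix.trace_sub, Matrix.mul_smul,
      Matrix.trace_smul, Matrix.mul_one, h.2.1.2, hθ, smul_eq_mul, mul_one, sub_self]
  have hKH : Kᴴ = K := by
    apply hinj
    have e : auxMap V ρss Kᴴ = (auxMap V ρss K)ᴴ := by
      rw [auxMap_apply, auxMap_apply, ← htr, ← chan_conj]
      simp
    rw [e, hK, conjTranspose_sub, hMH]
    simp
  have hexp : ∀ (s : ℝ) (X : Matrix (Fin d) (Fin d) ℂ), Vᴴ * ((s : ℂ) • V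
      - (X ⊗ₖ (1 : Matrix (Fin k) (Fin k) ℂ)) * V + V * X) = (s : ℂ) • 1 - chan V X + X := by
    intro s X
    rw [Matrix.mul_add, Matrix.mul_sub, chan_eq, Matrix.mul_smul, hV, ← Matrix.mul_assoc, hV,
      Matrix.one_mul]
  have hKeq : K - chan V K = Vᴴ * L - (θ : ℂ) • 1 := by
    rw [← hK, auxMap_apply, hK0, zero_smul, add_zero]
  refine ⟨(θ, K, L - ((θ : ℂ) • V
      - (K ⊗ₖ (1 : Matrix (Fin k) (Fin k) ℂ)) * V + V * K)), ⟨⟨hKH, hK0, ?_⟩, ?_⟩, ?_⟩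
  · dsimp only
    rw [Matrix.mul_assoc, Matrix.mul_sub, hexp]
    have : Vᴴ * L - ((θ : ℂ) • 1 - chan V K + K) = 0 := by
      have : (θ : ℂ) • 1 - chan V K + K = (θ : ℂ) • 1 + (K - chan V K) := by abel
      rw [this, hKeq]; abel
    rw [this, Matrix.mul_zero]
  · dsimp only
    abel
  · rintro ⟨s, X, L₀⟩ ⟨⟨hXH, hX0, hL0⟩, hLeq⟩
    dsimp only at hXH hX0 hL0 hLeq
    have hL0' : Vᴴ * L₀ = 0 := by
      have : Vᴴ * (V * Vᴴ * L₀) = 0 := by rw [hL0, Matrix.mul_zero]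
      rwa [← Matrix.mul_assoc, ← Matrix.mul_assoc, hV, Matrix.one_mul] at this
    have hM : Vᴴ * L = (s : ℂ) • 1 - chan V X + X := by
      rw [hLeq, Matrix.mul_add, hexp, hL0', add_zero]
    have haX : auxMap V ρss X = Vᴴ * L - (s : ℂ) • 1 := by
      rw [auxMap_apply, hX0, zero_smul, add_zero, hM]; abel
    have hs : (s : ℂ) = θ := by
      have := trace_auxMap V ρss h X
      rw [hX0, haX, Matrix.mul_sub, Matrix.trace_sub, Matrix.mul_smul,
        Matrix.trace_smul, Matrix.mul_one, h.2.1.2, ← hθ, smul_eq_mul, mul_one] at this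
      exact (sub_eq_zero.1 this).symm
    have hXK : X = K := hinj (by rw [haX, hK, hs])
    have hs' : s = θ := by exact_mod_cast hs
    subst hXK
    refine Prod.ext hs' (Prod.ext rfl ?_)
    dsimp only
    rw [← hs']
    exact eq_sub_of_add_eq' hLeq.symm

end QMCPaper
end
end

section
/- Let V be an isometry defining an irreducible quantum Markov chain with system dimension d and environment dimension k, with stationary state ρˢˢ, and let φ ∈ ℂ^d be a unit vector. Let A and B be (d·k)×d complex matrices admitting decompositions A = θ_A V − (K_A ⊗ 1_k) V + V K_A + A₀ and B = θ_B V − (K_B ⊗ 1_k) V + V K_B + B₀, where θ_A, θ_B ∈ ℝ, K_A, K_B are Hermitian d×d matrices with tr(ρˢˢ K_A) = tr(ρˢˢ K_B) = 0, and A₀, B₀ satisfy V Vᴴ A₀ = 0 and V Vᴴ B₀ = 0. Then the quantum Fisher information of the system-and-output state satisfies lim_{n→∞} F_n(A,B)/n = 4 Re tr(ρˢˢ A₀ᴴ B₀). In particular, if A₀ = 0 or B₀ = 0 (i.e. one of the directions is non-identifiable) then lim_{n→∞} F_n(A,B)/n = 0. -/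
open Matrix Filter
open scoped Kronecker ComplexConjugate ComplexOrder

noncomputable section

namespace QMCPaper

/-- The product `K_{i_{n-1}} ⋯ K_{i_0}` along a list `[i_0, …, i_{n-1}]`. -/
def krausList {d k : ℕ} (V : Matrix (Fin d × Fin k) (Fin d) ℂ)
    (L : List (Fin k)) : Matrix (Fin d) (Fin d) ℂ :=
  (L.reverse.map (kraus V)).prod

/-- The system–output vector `Ψ_n` at time `n` for initial system state `φ`. -/
def soVec {d k : ℕ} (V : Matrix (Fin d × Fin k) (Fin d) ℂ) (φ : Fin d → ℂ)
    (n : ℕ) : (Fin d × (Fin n → Fin k)) → ℂ :=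
  fun mi => (krausList V (List.ofFn mi.2) *ᵥ φ) mi.1

/-- The directional derivative `D_{A,n}` of the system–output vector in the
direction `A`. -/
def soDeriv {d k : ℕ} (V : Matrix (Fin d × Fin k) (Fin d) ℂ)
    (A : Matrix (Fin d × Fin k) (Fin d) ℂ) (φ : Fin d → ℂ) (n : ℕ) :
    (Fin d × (Fin n → Fin k)) → ℂ :=
  fun mi => ∑ l : Fin n,
    ((krausList V ((List.ofFn mi.2).drop ((l : ℕ) + 1)) *
        blk A (mi.2 l) *
        krausList V ((List.ofFn mi.2).take (l : ℕ))) *ᵥ φ) mi.1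

/-- The quantum Fisher information form of the system–output pure state model:
`F_n(A,B) = 4 Re(⟨D_A, D_B⟩ − ⟨D_A, Ψ⟩⟨Ψ, D_B⟩)`. -/
def qfi {d k : ℕ} (V : Matrix (Fin d × Fin k) (Fin d) ℂ) (φ : Fin d → ℂ)
    (A B : Matrix (Fin d × Fin k) (Fin d) ℂ) (n : ℕ) : ℝ :=
  4 * ((star (soDeriv V A φ n) ⬝ᵥ soDeriv V B φ n -
    (star (soDeriv V A φ n) ⬝ᵥ soVec V φ n) *
      (star (soVec V φ n) ⬝ᵥ soDeriv V B φ n)).re)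

/-- One step of the chain applied to a (system, output) vector. -/
def stepV {d k n : ℕ} (A : Matrix (Fin d × Fin k) (Fin d) ℂ)
    (u : Fin d × (Fin n → Fin k) → ℂ) : Fin d × (Fin (n + 1) → Fin k) → ℂ :=
  fun mi => (blk A (mi.2 (Fin.last n)) *ᵥ fun a => u (a, fun t => mi.2 t.castSucc)) mi.1

/-- A system operator applied to a (system, output) vector. -/
def appV {d k n : ℕ} (X : Matrix (Fin d) (Fin d) ℂ)
    (u : Fin d × (Fin n → Fin k) → ℂ) : Fin d × (Fin n → Fin k) → ℂ :=
  fun mi => (X *ᵥ fun a => u (a, mi.2)) mi.1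

/-- The reduced system state. -/
def redS {d k n : ℕ} (u : Fin d × (Fin n → Fin k) → ℂ) : Matrix (Fin d) (Fin d) ℂ :=
  (Matrix.of fun a i => u (a, i)) * (Matrix.of fun a i => u (a, i))ᴴ

lemma krausList_concat {d k : ℕ} (V : Matrix (Fin d × Fin k) (Fin d) ℂ)
    (L : List (Fin k)) (j : Fin k) : krausList V (L ++ [j]) = blk V j * krausList V L := by
  simp [krausList, kraus]

lemma krausList_nil {d k : ℕ} (V : Matrix (Fin d × Fin k) (Fin d) ℂ) :
    krausList V [] = 1 := by
  simp [krausList]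

lemma soVec_succ {d k : ℕ} (V : Matrix (Fin d × Fin k) (Fin d) ℂ) (φ : Fin d → ℂ) (n : ℕ) :
    soVec V φ (n + 1) = stepV V (soVec V φ n) := by
  funext mi
  simp only [soVec, stepV, List.ofFn_succ', List.concat_eq_append, krausList_concat]
  rw [← Matrix.mulVec_mulVec]

lemma soVec_zero {d k : ℕ} (V : Matrix (Fin d × Fin k) (Fin d) ℂ) (φ : Fin d → ℂ) :
    soVec V φ 0 = fun mi => φ mi.1 := by
  funext mi
  simp [soVec, krausList_nil]

lemma soDeriv_zero {d k : ℕ} (V A : Matrix (Fin d × Fin k) (Fin d) ℂ) (φ : Fin d → ℂ) :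
    soDeriv V A φ 0 = 0 := by
  funext mi
  simp [soDeriv]

lemma soDeriv_succ {d k : ℕ} (V A : Matrix (Fin d × Fin k) (Fin d) ℂ) (φ : Fin d → ℂ) (n : ℕ) :
    soDeriv V A φ (n + 1) = stepV V (soDeriv V A φ n) + stepV A (soVec V φ n) := by
  funext mi
  obtain ⟨m, i⟩ := mi
  simp only [soDeriv, stepV, Pi.add_apply, soVec]
  rw [Fin.sum_univ_castSucc]
  simp only [List.ofFn_succ', List.concat_eq_append]
  congr 1
  · have e : (fun a => ∑ l : Fin n, ((krausList V ((List.ofFn fun t => i t.castSucc).drop ((l : ℕ) + 1)) *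
        blk A (i l.castSucc) *
        krausList V ((List.ofFn fun t => i t.castSucc).take (l : ℕ))) *ᵥ φ) a)
        = ∑ l : Fin n, ((krausList V ((List.ofFn fun t => i t.castSucc).drop ((l : ℕ) + 1)) *
        blk A (i l.castSucc) *
        krausList V ((List.ofFn fun t => i t.castSucc).take (l : ℕ))) *ᵥ φ) := by
      funext a; simp [Finset.sum_apply]
    rw [e, Matrix.mulVec_sum, Finset.sum_apply]
    refine Finset.sum_congr rfl fun l _ => ?_
    have hl := l.2
    rw [List.drop_append_of_le_length (by simp),
      List.take_append_of_le_length (by simp)]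
    rw [krausList_concat, Matrix.mulVec_mulVec]
    simp only [Matrix.mul_assoc, Fin.val_castSucc]
  · rw [List.drop_of_length_le (by simp), List.take_append_of_le_length (by simp),
      List.take_of_length_le (by simp), krausList_nil, one_mul, ← Matrix.mulVec_mulVec]

lemma blk_sum {d k : ℕ} (A B : Matrix (Fin d × Fin k) (Fin d) ℂ) (u w : Fin d → ℂ) :
    ∑ j, star (blk A j *ᵥ u) ⬝ᵥ (blk B j *ᵥ w) = star u ⬝ᵥ ((Aᴴ * B) *ᵥ w) := by
  rw [← Matrix.mulVec_mulVec, Matrix.dotProduct_mulVec, ← Matrix.star_mulVec]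
  simp only [dotProduct]
  rw [Fintype.sum_prod_type, Finset.sum_comm]
  rfl

lemma sum_snoc {k n : ℕ} {M : Type*} [AddCommMonoid M] (f : (Fin (n + 1) → Fin k) → M) :
    ∑ i, f i = ∑ i : Fin n → Fin k, ∑ j : Fin k, f (Fin.snoc i j) := by
  rw [← (Fin.snocEquiv fun _ => Fin k).sum_comp, Fintype.sum_prod_type, Finset.sum_comm]
  rfl

lemma dot_prod {d k n : ℕ} (u w : Fin d × (Fin n → Fin k) → ℂ) :
    star u ⬝ᵥ w = ∑ i, star (fun a => u (a, i)) ⬝ᵥ (fun a => w (a, i)) := by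
  simp only [dotProduct]
  rw [Fintype.sum_prod_type, Finset.sum_comm]
  rfl

lemma dot_step {d k n : ℕ} (A B : Matrix (Fin d × Fin k) (Fin d) ℂ)
    (u w : Fin d × (Fin n → Fin k) → ℂ) :
    star (stepV A u) ⬝ᵥ stepV B w = star u ⬝ᵥ appV (Aᴴ * B) w := by
  rw [dot_prod, dot_prod, sum_snoc]
  refine Finset.sum_congr rfl fun i _ => ?_
  rw [show (fun a => appV (Aᴴ * B) w (a, i)) = (Aᴴ * B) *ᵥ fun a => w (a, i) from rfl, ← blk_sum]
  refine Finset.sum_congr rfl fun j _ => ?_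
  simp only [stepV, Fin.snoc_last, Fin.snoc_castSucc]

lemma appV_one {d k n : ℕ} (u : Fin d × (Fin n → Fin k) → ℂ) : appV 1 u = u := by
  funext mi; simp [appV]

lemma appV_zero {d k n : ℕ} (u : Fin d × (Fin n → Fin k) → ℂ) : appV 0 u = 0 := by
  funext mi; simp [appV]

lemma dot_app {d k n : ℕ} (X : Matrix (Fin d) (Fin d) ℂ) (u : Fin d × (Fin n → Fin k) → ℂ) :
    star u ⬝ᵥ appV X u = (redS u * X).trace := by
  rw [dot_prod]
  simp only [redS, Matrix.trace, Matrix.diag, Matrix.mul_apply, dotProduct, appV, Matrix.mulVec,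
    Matrix.of_apply, Matrix.conjTranspose_apply, Finset.sum_mul, Finset.mul_sum, Pi.star_apply]
  rw [Finset.sum_comm]
  rw [Finset.sum_congr rfl fun a _ => Finset.sum_comm]
  rw [Finset.sum_comm]
  refine Finset.sum_congr rfl fun a _ => Finset.sum_congr rfl fun b _ =>
    Finset.sum_congr rfl fun i _ => ?_
  ring

lemma dot_app_app {d k n : ℕ} (X Y : Matrix (Fin d) (Fin d) ℂ)
    (u w : Fin d × (Fin n → Fin k) → ℂ) :
    star (appV X u) ⬝ᵥ appV Y w = star u ⬝ᵥ appV (Xᴴ * Y) w := by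
  rw [dot_prod, dot_prod]
  refine Finset.sum_congr rfl fun i _ => ?_
  change star (X *ᵥ fun a => u (a, i)) ⬝ᵥ (Y *ᵥ fun a => w (a, i)) =
    star (fun a => u (a, i)) ⬝ᵥ ((Xᴴ * Y) *ᵥ fun a => w (a, i))
  rw [← Matrix.mulVec_mulVec, Matrix.dotProduct_mulVec _ Xᴴ, ← Matrix.star_mulVec]

lemma redS_step {d k n : ℕ} (V : Matrix (Fin d × Fin k) (Fin d) ℂ)
    (u : Fin d × (Fin n → Fin k) → ℂ) : redS (stepV V u) = predual V (redS u) := by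
  have e : predual V (redS u) = ∑ j, (kraus V j * (Matrix.of fun a i => u (a, i))) *
      (kraus V j * (Matrix.of fun a i => u (a, i)))ᴴ := by
    simp only [predual, redS, Matrix.conjTranspose_mul, Matrix.mul_assoc]
  rw [e]
  ext a b
  rw [Matrix.sum_apply]
  rw [show redS (stepV V u) a b = ∑ i, stepV V u (a, i) * star (stepV V u (b, i)) from rfl]
  rw [sum_snoc, Finset.sum_comm]
  refine Finset.sum_congr rfl fun j _ => Finset.sum_congr rfl fun i _ => ?_
  simp only [Matrix.of_apply, Matrix.conjTranspose_apply, stepV, Fin.snoc_last, Fin.snoc_castSucc]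
  rfl

lemma stepV_add {d k n : ℕ} (A : Matrix (Fin d × Fin k) (Fin d) ℂ)
    (u w : Fin d × (Fin n → Fin k) → ℂ) : stepV A (u + w) = stepV A u + stepV A w := by
  funext mi
  simp only [stepV, Pi.add_apply, Matrix.mulVec, dotProduct, mul_add, Finset.sum_add_distrib]

lemma dot_Psi {d k : ℕ} (V : Matrix (Fin d × Fin k) (Fin d) ℂ) (hV : Vᴴ * V = 1)
    (φ : Fin d → ℂ) (n : ℕ) : star (soVec V φ n) ⬝ᵥ soVec V φ n = star φ ⬝ᵥ φ := by
  induction n with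
  | zero => simp [soVec_zero, dot_prod]
  | succ n ih => rw [soVec_succ, dot_step, hV, appV_one, ih]

lemma dot_Psi_M {d k : ℕ} (V A : Matrix (Fin d × Fin k) (Fin d) ℂ) (hV : Vᴴ * V = 1)
    (hA : Vᴴ * A = 0)
    (φ : Fin d → ℂ) (n : ℕ) : star (soVec V φ n) ⬝ᵥ soDeriv V A φ n = 0 := by
  induction n with
  | zero => simp [soDeriv_zero]
  | succ n ih =>
    rw [soVec_succ, soDeriv_succ, dotProduct_add, dot_step, dot_step, hV, hA, appV_one, ih,
      appV_zero]
    simp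

lemma dot_M_M {d k : ℕ} (V A B : Matrix (Fin d × Fin k) (Fin d) ℂ) (hV : Vᴴ * V = 1)
    (hA : Vᴴ * A = 0) (hB : Vᴴ * B = 0)
    (φ : Fin d → ℂ) (n : ℕ) : star (soDeriv V A φ n) ⬝ᵥ soDeriv V B φ n =
      ((∑ l ∈ Finset.range n, redS (soVec V φ l)) * (Aᴴ * B)).trace := by
  have hA' : Aᴴ * V = 0 := by
    have := congrArg Matrix.conjTranspose hA
    simpa using this
  induction n with
  | zero => simp [soDeriv_zero]
  | succ n ih =>
    rw [soDeriv_succ, soDeriv_succ, star_add, dotProduct_add, add_dotProduct, add_dotProduct,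
      dot_step, dot_step, dot_step, dot_step, hV, hA', hB, appV_one, ih, appV_zero, appV_zero,
      dot_app, Finset.sum_range_succ, Matrix.add_mul, Matrix.trace_add]
    simp

lemma deriv_add {d k : ℕ} (V A B : Matrix (Fin d × Fin k) (Fin d) ℂ) (φ : Fin d → ℂ) (n : ℕ) :
    soDeriv V (A + B) φ n = soDeriv V A φ n + soDeriv V B φ n := by
  funext mi
  simp only [soDeriv, Pi.add_apply]
  rw [← Finset.sum_add_distrib]
  refine Finset.sum_congr rfl fun l _ => ?_
  rw [show blk (A + B) (mi.2 l) = blk A (mi.2 l) + blk B (mi.2 l) from rfl, Matrix.mul_add,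
    Matrix.add_mul, Matrix.add_mulVec, Pi.add_apply]

lemma deriv_smul_V {d k : ℕ} (V : Matrix (Fin d × Fin k) (Fin d) ℂ) (c : ℂ)
    (φ : Fin d → ℂ) (n : ℕ) :
    soDeriv V (c • V) φ n = (n * c) • soVec V φ n := by
  induction n with
  | zero => simp [soDeriv_zero]
  | succ n ih =>
    rw [soDeriv_succ, ih, soVec_succ]
    funext mi
    simp only [stepV, Pi.add_apply, Pi.smul_apply, smul_eq_mul]
    rw [show blk (c • V) (mi.2 (Fin.last n)) = c • blk V (mi.2 (Fin.last n)) from rfl]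
    simp only [Matrix.mulVec, dotProduct, Matrix.smul_apply, smul_eq_mul, Finset.mul_sum]
    rw [← Finset.sum_add_distrib]
    refine Finset.sum_congr rfl fun a _ => ?_
    push_cast
    ring

lemma blk_kron {d k : ℕ} (K : Matrix (Fin d) (Fin d) ℂ) (V : Matrix (Fin d × Fin k) (Fin d) ℂ)
    (j : Fin k) : blk ((K ⊗ₖ (1 : Matrix (Fin k) (Fin k) ℂ)) * V) j = K * blk V j := by
  ext a b
  simp [blk, Matrix.mul_apply, Fintype.sum_prod_type, Matrix.one_apply]

lemma deriv_gauge {d k : ℕ} (V : Matrix (Fin d × Fin k) (Fin d) ℂ) (K : Matrix (Fin d) (Fin d) ℂ)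
    (φ : Fin d → ℂ) (n : ℕ) :
    soDeriv V (V * K - (K ⊗ₖ (1 : Matrix (Fin k) (Fin k) ℂ)) * V) φ n
      = soVec V (K *ᵥ φ) n - appV K (soVec V φ n) := by
  induction n with
  | zero =>
    rw [soDeriv_zero, soVec_zero, soVec_zero]
    funext mi
    simp [appV]
  | succ n ih =>
    rw [soDeriv_succ, ih, soVec_succ, soVec_succ]
    funext mi
    obtain ⟨m, i⟩ := mi
    simp only [stepV, Pi.add_apply, Pi.sub_apply, appV]
    rw [show blk (V * K - (K ⊗ₖ (1 : Matrix (Fin k) (Fin k) ℂ)) * V) (i (Fin.last n))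
      = blk V (i (Fin.last n)) * K - blk ((K ⊗ₖ (1 : Matrix (Fin k) (Fin k) ℂ)) * V) (i (Fin.last n))
      from rfl, blk_kron]
    set g := fun a => soVec V φ n (a, fun t => i t.castSucc) with hg
    set f := fun a => soVec V (K *ᵥ φ) n (a, fun t => i t.castSucc) with hf
    have e1 : (fun a => soVec V (K *ᵥ φ) n (a, fun t => i t.castSucc) - (K *ᵥ g) a) =
      f - K *ᵥ g := rfl
    rw [e1]
    change _ = (blk V (i (Fin.last n)) *ᵥ f) m - (K *ᵥ (blk V (i (Fin.last n)) *ᵥ g)) m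
    rw [Matrix.mulVec_sub, Matrix.sub_mulVec, Matrix.mulVec_mulVec, Matrix.mulVec_mulVec]
    simp

/-! ### Cesàro convergence of states -/

lemma state_entry {d : ℕ} {ρ : Matrix (Fin d) (Fin d) ℂ} (h : IsState ρ) (a b : Fin d) :
    ‖ρ a b‖ ≤ 1 := by
  obtain ⟨hp, ht⟩ := h
  have hdiag : ∀ a, 0 ≤ ρ a a := fun a => hp.diag_nonneg
  have hle : ∀ a, (ρ a a).re ≤ 1 := by
    intro a
    have : ∑ a, (ρ a a).re = 1 := by
      have := congrArg Complex.re ht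
      simpa [Matrix.trace] using this
    rw [← this]
    exact Finset.single_le_sum (f := fun a => (ρ a a).re)
      (fun i _ => (Complex.le_def.1 (hdiag i)).1) (Finset.mem_univ a)
  have hdet := (hp.submatrix ![a, b]).det_nonneg
  rw [Matrix.det_fin_two] at hdet
  simp only [Matrix.submatrix_apply, Matrix.cons_val_zero, Matrix.cons_val_one] at hdet
  have hh : ρ b a = star (ρ a b) := (hp.1.apply b a).symm
  rw [hh] at hdet
  have h1 := (Complex.le_def.1 hdet).1
  have ha := Complex.le_def.1 (hdiag a)
  have hb := Complex.le_def.1 (hdiag b)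
  simp only [Complex.zero_re, Complex.zero_im, Complex.sub_re, Complex.mul_re, Complex.star_def,
    Complex.conj_re, Complex.conj_im] at h1 ha hb
  have h2 : ‖ρ a b‖ ^ 2 ≤ 1 := by
    rw [Complex.sq_norm, Complex.normSq_apply]
    rw [← ha.2] at h1
    nlinarith [mul_le_one₀ (hle a) hb.1 (hle b)]
  nlinarith [norm_nonneg (ρ a b)]

lemma state_compact (d : ℕ) : IsCompact {ρ : Matrix (Fin d) (Fin d) ℂ | IsState ρ} := by
  have hK : IsCompact (Set.univ.pi fun _ : Fin d => Set.univ.pi fun _ : Fin d =>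
      Metric.closedBall (0 : ℂ) 1) :=
    isCompact_univ_pi fun _ => isCompact_univ_pi fun _ => isCompact_closedBall _ _
  refine IsCompact.of_isClosed_subset hK ?_ ?_
  · have e : {ρ : Matrix (Fin d) (Fin d) ℂ | IsState ρ} =
        {ρ | ρᴴ = ρ} ∩ (⋂ x : Fin d → ℂ, {ρ | 0 ≤ star x ⬝ᵥ (ρ *ᵥ x)}) ∩ {ρ | ρ.trace = 1} := by
      ext ρ
      simp [IsState, Matrix.posSemidef_iff_dotProduct_mulVec, Matrix.IsHermitian]
    rw [e]
    refine ((isClosed_eq (by fun_prop) (by fun_prop)).inter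
      (isClosed_iInter fun x => ?_)).inter (isClosed_eq (by fun_prop) (by fun_prop))
    exact isClosed_le continuous_const (by fun_prop)
  · intro ρ hρ a _ b _
    simpa using state_entry hρ a b

lemma predual_cont {d k : ℕ} (V : Matrix (Fin d × Fin k) (Fin d) ℂ) :
    Continuous (predual V) := by
  unfold predual
  fun_prop

lemma cesaro {d k : ℕ} (V : Matrix (Fin d × Fin k) (Fin d) ℂ) (ρss : Matrix (Fin d) (Fin d) ℂ)
    (hu : ∀ ρ, IsState ρ → predual V ρ = ρ → ρ = ρss)
    (r : ℕ → Matrix (Fin d) (Fin d) ℂ) (hr : ∀ n, IsState (r n))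
    (hs : ∀ n, r (n + 1) = predual V (r n)) :
    Tendsto (fun n : ℕ => (n : ℂ)⁻¹ • ∑ l ∈ Finset.range n, r l) atTop (nhds ρss) := by
  set S := fun n : ℕ => (n : ℂ)⁻¹ • ∑ l ∈ Finset.range n, r l with hS
  refine (state_compact d).tendsto_nhds_of_unique_mapClusterPt ?_ ?_
  · filter_upwards [eventually_ge_atTop 1] with n hn
    have hn0 : (n : ℂ) ≠ 0 := by exact_mod_cast (by omega : n ≠ 0)
    refine ⟨?_, ?_⟩
    · refine Matrix.PosSemidef.smul (Matrix.posSemidef_sum _ fun i _ => (hr i).1) ?_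
      rw [← Complex.ofReal_natCast, ← Complex.ofReal_inv]
      exact Complex.zero_le_real.2 (by positivity)
    · simp only [hS, Matrix.trace_smul, Matrix.trace_sum, (hr _).2]
      simp [hn0]
  · intro x hx hc
    refine hu x hx ?_
    have hg : Continuous fun ρ => predual V ρ - ρ := (predual_cont V).sub continuous_id
    have hc' := hc.tendsto_comp (hg.tendsto x)
    have hlim : Tendsto ((fun ρ => predual V ρ - ρ) ∘ S) atTop (nhds 0) := by
      have e : ((fun ρ => predual V ρ - ρ) ∘ S) = fun n : ℕ => (n : ℂ)⁻¹ • (r n - r 0) := by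
        funext n
        have : predual V (S n) = (n : ℂ)⁻¹ • ∑ l ∈ Finset.range n, predual V (r l) := by
          simp only [hS, predual, Matrix.mul_smul, Matrix.smul_mul, Matrix.mul_sum, Matrix.sum_mul,
            Finset.smul_sum]
          rw [Finset.sum_comm]
        simp only [Function.comp, this]
        rw [hS, ← smul_sub, ← Finset.sum_sub_distrib]
        simp only [← hs, Finset.sum_range_sub]
      rw [e]
      refine tendsto_pi_nhds.2 fun a => tendsto_pi_nhds.2 fun b => ?_
      have hb : ∀ n, ‖(r n - r 0) a b‖ ≤ 2 := fun n => by
        rw [Matrix.sub_apply]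
        refine (norm_sub_le _ _).trans ?_
        linarith [state_entry (hr n) a b, state_entry (hr 0) a b]
      refine squeeze_zero_norm (a := fun n : ℕ => (n : ℝ)⁻¹ * 2) (fun n => ?_) ?_
      · simp only [Matrix.smul_apply, norm_smul, norm_inv, Complex.norm_natCast]
        gcongr
        exact hb n
      · simpa using (tendsto_inv_atTop_nhds_zero_nat (𝕜 := ℝ)).mul_const 2
    have : predual V x - x = 0 := by
      have h1 : ClusterPt (predual V x - x) (nhds 0) := ClusterPt.mono hc' hlim
      exact eq_of_nhds_neBot h1
    exact sub_eq_zero.1 this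

/-! ### Norm estimates -/

/-- Euclidean norm of a finite vector. -/
def nrm {ι : Type} [Fintype ι] (u : ι → ℂ) : ℝ := ‖WithLp.toLp 2 u‖

lemma dot_inner {ι : Type} [Fintype ι] (u w : ι → ℂ) :
    star u ⬝ᵥ w = inner ℂ (WithLp.toLp 2 u) (WithLp.toLp 2 w) := by
  rw [EuclideanSpace.inner_eq_star_dotProduct, dotProduct_comm]

lemma nrm_nonneg {ι : Type} [Fintype ι] (u : ι → ℂ) : 0 ≤ nrm u := norm_nonneg _

lemma nrm_sq {ι : Type} [Fintype ι] (u : ι → ℂ) : nrm u ^ 2 = (star u ⬝ᵥ u).re := by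
  rw [dot_inner, nrm, inner_self_eq_norm_sq_to_K]
  norm_cast

lemma dot_le {ι : Type} [Fintype ι] (u w : ι → ℂ) : ‖star u ⬝ᵥ w‖ ≤ nrm u * nrm w := by
  rw [dot_inner]
  exact norm_inner_le_norm _ _

lemma nrm_sub_le {ι : Type} [Fintype ι] (u w : ι → ℂ) : nrm (u - w) ≤ nrm u + nrm w := by
  simp only [nrm, WithLp.toLp_sub]
  exact norm_sub_le _ _

lemma redS_state {d k : ℕ} (V : Matrix (Fin d × Fin k) (Fin d) ℂ) (hV : Vᴴ * V = 1)
    (φ : Fin d → ℂ) (hφ : star φ ⬝ᵥ φ = 1) (n : ℕ) : IsState (redS (soVec V φ n)) := by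
  refine ⟨Matrix.posSemidef_self_mul_conjTranspose _, ?_⟩
  have := dot_app 1 (soVec V φ n)
  rw [appV_one, dot_Psi V hV, hφ, Matrix.mul_one] at this
  exact this.symm

lemma R_bound {d k : ℕ} (V : Matrix (Fin d × Fin k) (Fin d) ℂ) (hV : Vᴴ * V = 1)
    (φ : Fin d → ℂ) (hφ : star φ ⬝ᵥ φ = 1) (K : Matrix (Fin d) (Fin d) ℂ) :
    ∃ C : ℝ, 0 ≤ C ∧ ∀ n, nrm (soVec V (K *ᵥ φ) n - appV K (soVec V φ n)) ≤ C := by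
  set c := ∑ a, ∑ b, ‖(Kᴴ * K) b a‖ with hc
  refine ⟨√((star (K *ᵥ φ) ⬝ᵥ (K *ᵥ φ)).re) + √c, by positivity, fun n => ?_⟩
  refine (nrm_sub_le _ _).trans (add_le_add ?_ ?_)
  · refine Real.le_sqrt_of_sq_le ?_
    rw [nrm_sq, dot_Psi V hV]
  · refine Real.le_sqrt_of_sq_le ?_
    rw [nrm_sq, dot_app_app, dot_app]
    refine (Complex.re_le_norm _).trans ?_
    simp only [Matrix.trace, Matrix.diag, Matrix.mul_apply (M := redS (soVec V φ n))]
    refine (norm_sum_le _ _).trans (Finset.sum_le_sum fun a _ => ?_)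
    refine (norm_sum_le _ _).trans (Finset.sum_le_sum fun b _ => ?_)
    rw [norm_mul]
    exact mul_le_of_le_one_left (norm_nonneg _) (state_entry (redS_state V hV φ hφ n) a b)

lemma M_lim {d k : ℕ} (V : Matrix (Fin d × Fin k) (Fin d) ℂ) (ρss : Matrix (Fin d) (Fin d) ℂ)
    (h : IsIrreducible V ρss) (φ : Fin d → ℂ) (hφ : star φ ⬝ᵥ φ = 1)
    (A B : Matrix (Fin d × Fin k) (Fin d) ℂ) (hA : Vᴴ * A = 0) (hB : Vᴴ * B = 0) :
    Tendsto (fun n : ℕ => (n : ℂ)⁻¹ * (star (soDeriv V A φ n) ⬝ᵥ soDeriv V B φ n)) atTop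
      (nhds (ρss * Aᴴ * B).trace) := by
  obtain ⟨hV, -, -, -, hu⟩ := h
  have hc := cesaro V ρss hu (fun n => redS (soVec V φ n)) (redS_state V hV φ hφ)
    (fun n => by rw [soVec_succ, redS_step])
  have hcont : Continuous fun ρ : Matrix (Fin d) (Fin d) ℂ => (ρ * (Aᴴ * B)).trace := by fun_prop
  have := (hcont.tendsto ρss).comp hc
  rw [Matrix.mul_assoc]
  refine this.congr fun n => ?_
  rw [dot_M_M V A B hV hA hB]
  simp [Function.comp, Matrix.smul_mul, Matrix.trace_smul]

lemma M_small {d k : ℕ} (V : Matrix (Fin d × Fin k) (Fin d) ℂ) (ρss : Matrix (Fin d) (Fin d) ℂ)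
    (h : IsIrreducible V ρss) (φ : Fin d → ℂ) (hφ : star φ ⬝ᵥ φ = 1)
    (A : Matrix (Fin d × Fin k) (Fin d) ℂ) (hA : Vᴴ * A = 0) :
    Tendsto (fun n : ℕ => (n : ℝ)⁻¹ * nrm (soDeriv V A φ n)) atTop (nhds 0) := by
  have h1 := (Complex.continuous_re.tendsto _).comp (M_lim V ρss h φ hφ A A hA hA)
  have h2 := (tendsto_inv_atTop_nhds_zero_nat (𝕜 := ℝ)).mul h1
  rw [zero_mul] at h2
  have h3 := (Real.continuous_sqrt.tendsto _).comp h2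
  rw [Real.sqrt_zero] at h3
  refine h3.congr fun n => ?_
  have e : (n : ℝ)⁻¹ * ((Complex.re ∘ fun n : ℕ => (n : ℂ)⁻¹ *
      (star (soDeriv V A φ n) ⬝ᵥ soDeriv V A φ n)) n) = ((n : ℝ)⁻¹ * nrm (soDeriv V A φ n)) ^ 2 := by
    rw [mul_pow, nrm_sq]
    simp only [Function.comp]
    rw [← Complex.ofReal_natCast, ← Complex.ofReal_inv, Complex.re_ofReal_mul]
    ring
  rw [Function.comp, e, Real.sqrt_sq]
  exact mul_nonneg (by positivity) (nrm_nonneg _)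

lemma small_of_le (z : ℕ → ℂ) (g : ℕ → ℝ) (hz : ∀ n, ‖z n‖ ≤ g n)
    (hg : Tendsto (fun n : ℕ => (n : ℝ)⁻¹ * g n) atTop (nhds 0)) :
    Tendsto (fun n : ℕ => (n : ℂ)⁻¹ * z n) atTop (nhds 0) := by
  refine squeeze_zero_norm (fun n => ?_) hg
  rw [norm_mul, norm_inv, Complex.norm_natCast]
  exact mul_le_mul_of_nonneg_left (hz n) (by positivity)

lemma form_expand {ι : Type} [Fintype ι] (P RA RB MA MB : ι → ℂ) (a b : ℂ)
    (hP : star P ⬝ᵥ P = 1) (hA : star P ⬝ᵥ MA = 0) (hB : star P ⬝ᵥ MB = 0) :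
    star (a • P + RA + MA) ⬝ᵥ (b • P + RB + MB) -
      (star (a • P + RA + MA) ⬝ᵥ P) * (star P ⬝ᵥ (b • P + RB + MB)) =
    star RA ⬝ᵥ RB - (star RA ⬝ᵥ P) * (star P ⬝ᵥ RB) + star RA ⬝ᵥ MB + star MA ⬝ᵥ RB
      + star MA ⬝ᵥ MB := by
  have hA' : star MA ⬝ᵥ P = 0 := by
    have := congrArg star hA
    rwa [Matrix.star_dotProduct, star_zero, star_star] at this
  simp only [star_add, star_smul, add_dotProduct, dotProduct_add, smul_dotProduct, dotProduct_smul,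
    hP, hA, hB, hA', smul_eq_mul]
  ring

lemma deriv_dec {d k : ℕ} (V : Matrix (Fin d × Fin k) (Fin d) ℂ) (hV : Vᴴ * V = 1)
    (φ : Fin d → ℂ) (A A₀ : Matrix (Fin d × Fin k) (Fin d) ℂ) (θ : ℝ)
    (K : Matrix (Fin d) (Fin d) ℂ)
    (hA : A = (θ : ℂ) • V - (K ⊗ₖ (1 : Matrix (Fin k) (Fin k) ℂ)) * V + V * K + A₀) (n : ℕ) :
    soDeriv V A φ n = ((n : ℂ) * θ) • soVec V φ n +
      (soVec V (K *ᵥ φ) n - appV K (soVec V φ n)) + soDeriv V A₀ φ n := by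
  have : A = (θ : ℂ) • V + (V * K - (K ⊗ₖ (1 : Matrix (Fin k) (Fin k) ℂ)) * V) + A₀ := by
    rw [hA]; abel
  rw [this, deriv_add, deriv_add, deriv_smul_V, deriv_gauge]

/-- Proposition: convergence of the QFI rate; only the identifiable
components of the directions contribute. -/
theorem qfi_rate_convergence {d k : ℕ}
    (V : Matrix (Fin d × Fin k) (Fin d) ℂ) (ρss : Matrix (Fin d) (Fin d) ℂ)
    (h : IsIrreducible V ρss)
    (φ : Fin d → ℂ) (hφ : star φ ⬝ᵥ φ = 1)
    (A B A₀ B₀ : Matrix (Fin d × Fin k) (Fin d) ℂ)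
    (θA θB : ℝ) (KA KB : Matrix (Fin d) (Fin d) ℂ)
    (hKA : KA.IsHermitian) (hKB : KB.IsHermitian)
    (hKAtr : (ρss * KA).trace = 0) (hKBtr : (ρss * KB).trace = 0)
    (hA₀ : V * Vᴴ * A₀ = 0) (hB₀ : V * Vᴴ * B₀ = 0)
    (hAdec : A = (θA : ℂ) • V - (KA ⊗ₖ (1 : Matrix (Fin k) (Fin k) ℂ)) * V
      + V * KA + A₀)
    (hBdec : B = (θB : ℂ) • V - (KB ⊗ₖ (1 : Matrix (Fin k) (Fin k) ℂ)) * V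
      + V * KB + B₀) :
    Tendsto (fun n : ℕ => qfi V φ A B n / (n : ℝ)) atTop
      (nhds (4 * ((ρss * A₀ᴴ * B₀).trace).re)) ∧
    ((A₀ = 0 ∨ B₀ = 0) →
      Tendsto (fun n : ℕ => qfi V φ A B n / (n : ℝ)) atTop (nhds 0)) := by
  have key : Tendsto (fun n : ℕ => qfi V φ A B n / (n : ℝ)) atTop
      (nhds (4 * ((ρss * A₀ᴴ * B₀).trace).re)) := by
    have hV := h.1
    have hA1 : Vᴴ * A₀ = 0 := by
      have := congrArg (fun X => Vᴴ * X) hA₀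
      simpa only [← Matrix.mul_assoc, hV, Matrix.one_mul, Matrix.mul_zero] using this
    have hB1 : Vᴴ * B₀ = 0 := by
      have := congrArg (fun X => Vᴴ * X) hB₀
      simpa only [← Matrix.mul_assoc, hV, Matrix.one_mul, Matrix.mul_zero] using this
    obtain ⟨CA, hCA0, hCA⟩ := R_bound V hV φ hφ KA
    obtain ⟨CB, hCB0, hCB⟩ := R_bound V hV φ hφ KB
    set P := fun n => soVec V φ n with hPdef
    set RA := fun n => soVec V (KA *ᵥ φ) n - appV KA (soVec V φ n) with hRA
    set RB := fun n => soVec V (KB *ᵥ φ) n - appV KB (soVec V φ n) with hRB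
    have hP : ∀ n, star (P n) ⬝ᵥ P n = 1 := fun n => by rw [hPdef, dot_Psi V hV, hφ]
    have hP1 : ∀ n, nrm (P n) ≤ 1 := fun n => by
      have := nrm_sq (P n)
      rw [hP n, Complex.one_re] at this
      nlinarith [nrm_nonneg (P n)]
    have hconst : ∀ C : ℝ, Tendsto (fun n : ℕ => (n : ℝ)⁻¹ * C) atTop (nhds 0) := fun C => by
      simpa using (tendsto_inv_atTop_nhds_zero_nat (𝕜 := ℝ)).mul_const C
    have t1 := small_of_le (fun n => star (RA n) ⬝ᵥ RB n) (fun _ => CA * CB)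
      (fun n => (dot_le _ _).trans (mul_le_mul (hCA n) (hCB n) (nrm_nonneg _) hCA0)) (hconst _)
    have t2 := small_of_le (fun n => (star (RA n) ⬝ᵥ P n) * (star (P n) ⬝ᵥ RB n))
      (fun _ => (CA * 1) * (1 * CB))
      (fun n => by
        rw [norm_mul]
        refine mul_le_mul ?_ ?_ (norm_nonneg _) (by positivity)
        · exact (dot_le _ _).trans (mul_le_mul (hCA n) (hP1 n) (nrm_nonneg _) hCA0)
        · exact (dot_le _ _).trans (mul_le_mul (hP1 n) (hCB n) (nrm_nonneg _) zero_le_one))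
      (hconst _)
    have t3 := small_of_le (fun n => star (RA n) ⬝ᵥ soDeriv V B₀ φ n)
      (fun n => CA * nrm (soDeriv V B₀ φ n))
      (fun n => (dot_le _ _).trans (mul_le_mul_of_nonneg_right (hCA n) (nrm_nonneg _)))
      (by
        have := (M_small V ρss h φ hφ B₀ hB1).const_mul CA
        rw [mul_zero] at this
        exact this.congr fun n => by ring)
    have t4 := small_of_le (fun n => star (soDeriv V A₀ φ n) ⬝ᵥ RB n)
      (fun n => nrm (soDeriv V A₀ φ n) * CB)
      (fun n => (dot_le _ _).trans (mul_le_mul_of_nonneg_left (hCB n) (nrm_nonneg _)))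
      (by
        have := (M_small V ρss h φ hφ A₀ hA1).mul_const CB
        rw [zero_mul] at this
        exact this.congr fun n => by ring)
    have t5 := M_lim V ρss h φ hφ A₀ B₀ hA1 hB1
    have t := ((((t1.sub t2).add t3).add t4).add t5)
    have t' := ((Complex.continuous_re.tendsto _).comp t).const_mul 4
    simp only [sub_zero, zero_add] at t'
    refine t'.congr fun n => ?_
    have e := form_expand (P n) (RA n) (RB n) (soDeriv V A₀ φ n) (soDeriv V B₀ φ n)
      ((n : ℂ) * θA) ((n : ℂ) * θB) (hP n) (dot_Psi_M V A₀ hV hA1 φ n) (dot_Psi_M V B₀ hV hB1 φ n)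
    rw [qfi, deriv_dec V hV φ A A₀ θA KA hAdec n, deriv_dec V hV φ B B₀ θB KB hBdec n, e]
    simp only [Function.comp]
    rw [← mul_sub, ← mul_add, ← mul_add, ← mul_add, ← Complex.ofReal_natCast, ← Complex.ofReal_inv,
      Complex.re_ofReal_mul]
    ring
  refine ⟨key, ?_⟩
  rintro (h0 | h0)
  · simpa [h0] using key
  · simpa [h0] using key

end QMCPaper
end
end
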